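/- Let P be a PAG over a finite node set V that is adjustment amenable relative to disjoint nonempty node sets (X,Y), and let Z ⊆ V be disjoint from X ∪ Y. Then Z ∩ Forb(X,Y,P) = ∅ (condition (1) of the GAC) if and only if for every MAG M ∈ [P], no element of Z is a descendant in M of any node W ∉ X lying on a proper causal path from X to Y in M (condition (a) of the AC). -/

import Mathlib

open scoped Classical

/-- Edge marks: tail, arrowhead, circle. -/
inductive Mark : Type
  | tail
  | arrow
  | circle
  deriving DecidableEq

/-- A partial mixed graph over a node set `V`: any two distinct nodes are joined by
at most one edge; `mark a b` is the mark at `b` on the edge between `a` and `b`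
(`none` if there is no edge). -/
structure PMG (V : Type) where
  mark : V → V → Option Mark
  symm : ∀ a b, (mark a b).isSome ↔ (mark b a).isSome
  irrefl : ∀ a, mark a a = none

namespace PMG

variable {V : Type}

/-- `a` and `b` are adjacent. -/
def Adj (G : PMG V) (a b : V) : Prop := (G.mark a b).isSome

/-- directed edge `a → b`. -/
def DirEdge (G : PMG V) (a b : V) : Prop :=
  G.mark a b = some Mark.arrow ∧ G.mark b a = some Mark.tail

/-- bidirected edge `a ↔ b`. -/
def BidirEdge (G : PMG V) (a b : V) : Prop :=
  G.mark a b = some Mark.arrow ∧ G.mark b a = some Mark.arrow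

/-- non-directed edge `a o-o b`. -/
def NondirEdge (G : PMG V) (a b : V) : Prop :=
  G.mark a b = some Mark.circle ∧ G.mark b a = some Mark.circle

/-- A path: a nonempty list of distinct nodes in which successive nodes are adjacent. -/
def IsPath (G : PMG V) (p : List V) : Prop :=
  p ≠ [] ∧ p.Nodup ∧ p.Chain' G.Adj

/-- A path from `a` to `b` (with at least one edge). -/
def IsPathFromTo (G : PMG V) (p : List V) (a b : V) : Prop :=
  IsPath G p ∧ p.head? = some a ∧ p.getLast? = some b ∧ 2 ≤ p.length

/-- All edges on `p` are directed towards the end of `p`. -/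
def DirectedAlong (G : PMG V) (p : List V) : Prop :=
  ∀ i a b, p[i]? = some a → p[i+1]? = some b → G.DirEdge a b

/-- No edge on `p` has an arrowhead at its endpoint closer to the start of `p`
(`p` is possibly directed). -/
def PossDirAlong (G : PMG V) (p : List V) : Prop :=
  ∀ i a b, p[i]? = some a → p[i+1]? = some b → G.mark b a ≠ some Mark.arrow

/-- `b` is a descendant of `a`: a directed path (possibly of length 0) from `a` to `b`. -/
def Descendant (G : PMG V) (a b : V) : Prop :=
  ∃ p, IsPath G p ∧ DirectedAlong G p ∧ p.head? = some a ∧ p.getLast? = some b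

/-- `b` is a possible descendant of `a`. -/
def PossDescendant (G : PMG V) (a b : V) : Prop :=
  ∃ p, IsPath G p ∧ PossDirAlong G p ∧ p.head? = some a ∧ p.getLast? = some b

/-- The node at position `i+1` of `p` is a collider on `p`. -/
def ColliderAt (G : PMG V) (p : List V) (i : ℕ) : Prop :=
  ∃ a b c, p[i]? = some a ∧ p[i+1]? = some b ∧ p[i+2]? = some c ∧
    G.mark a b = some Mark.arrow ∧ G.mark c b = some Mark.arrow

/-- The node at position `i+1` of `p` is a definite non-collider on `p`. -/
def DefNonColliderAt (G : PMG V) (p : List V) (i : ℕ) : Prop :=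
  ∃ a b c, p[i]? = some a ∧ p[i+1]? = some b ∧ p[i+2]? = some c ∧
    (G.mark a b = some Mark.tail ∨ G.mark c b = some Mark.tail ∨
      (G.mark a b = some Mark.circle ∧ G.mark c b = some Mark.circle ∧ ¬ G.Adj a c))

/-- `p` is of definite status. -/
def DefStatus (G : PMG V) (p : List V) : Prop :=
  ∀ i, i + 2 < p.length → (ColliderAt G p i ∨ DefNonColliderAt G p i)

/-- `p` is a definite status path that is m-connecting given `Z`. -/
def MConn (G : PMG V) (Z : Finset V) (p : List V) : Prop :=
  DefStatus G p ∧
  (∀ i b, p[i+1]? = some b → DefNonColliderAt G p i → b ∉ Z) ∧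
  (∀ i b, p[i+1]? = some b → ColliderAt G p i → ∃ z ∈ Z, Descendant G b z)

/-- `a` and `b` are m-separated given `Z`: every definite status path between them
is blocked by `Z`. -/
def MSep (G : PMG V) (a b : V) (Z : Finset V) : Prop :=
  ∀ p, IsPathFromTo G p a b → ¬ MConn G Z p

/-- Two graphs have the same m-separation relations. -/
def MarkovEquiv (G H : PMG V) : Prop :=
  ∀ a b (Z : Finset V), a ≠ b → a ∉ Z → b ∉ Z → (MSep G a b Z ↔ MSep H a b Z)

/-- `G` is a DAG: all edges directed and no directed cycle. -/
def IsDAG (G : PMG V) : Prop :=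
  (∀ a b, G.Adj a b → G.DirEdge a b ∨ G.DirEdge b a) ∧
  (∀ a b, Descendant G a b → Descendant G b a → a = b)

/-- A mixed graph: edges only `→` or `↔`. -/
def IsMixed (G : PMG V) : Prop :=
  ∀ a b, G.Adj a b → G.DirEdge a b ∨ G.DirEdge b a ∨ G.BidirEdge a b

/-- Ancestral mixed graph: no directed cycle, no almost directed cycle. -/
def IsAncestral (G : PMG V) : Prop :=
  IsMixed G ∧ (∀ a b, Descendant G a b → Descendant G b a → a = b) ∧
  (∀ a b, Descendant G a b → ¬ G.BidirEdge b a)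

/-- Maximal ancestral graph. -/
def IsMAG (G : PMG V) : Prop :=
  IsAncestral G ∧ ∀ a b : V, a ≠ b → ¬ G.Adj a b →
    ∃ Z : Finset V, a ∉ Z ∧ b ∉ Z ∧ MSep G a b Z

/-- A collider path from `v` to `x` that is into `x` and all of whose
non-endpoint nodes are parents of `y`. -/
def ColliderPathInto (G : PMG V) (v x y : V) : Prop :=
  ∃ p : List V, IsPathFromTo G p v x ∧
    (∀ i, i + 2 < p.length → ColliderAt G p i) ∧
    (∃ a, p[p.length - 2]? = some a ∧ G.mark a x = some Mark.arrow) ∧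
    (∀ c ∈ p, c ≠ v → c ≠ x → G.DirEdge c y)

/-- The directed edge `x → y` is visible (in a MAG or PAG). -/
def Visible (G : PMG V) (x y : V) : Prop :=
  G.DirEdge x y ∧
  ∃ v, v ≠ y ∧ ¬ G.Adj v y ∧
    (G.mark v x = some Mark.arrow ∨ ColliderPathInto G v x y)

/-- `p` is a proper path from the node set `X` to the node set `Y`. -/
def ProperPath (G : PMG V) (X Y : Finset V) (p : List V) : Prop :=
  IsPath G p ∧ (∃ a ∈ X, p.head? = some a) ∧ (∃ b ∈ Y, p.getLast? = some b) ∧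
  (∀ c ∈ p.tail, c ∉ X)

/-- `p` starts with an edge satisfying `vis` out of its first node. -/
def StartsVisible (vis : V → V → Prop) (p : List V) : Prop :=
  ∃ a b, p[0]? = some a ∧ p[1]? = some b ∧ vis a b

/-- Adjustment amenability relative to `(X,Y)`, with visibility predicate `vis`. -/
def Amenable (G : PMG V) (vis : V → V → Prop) (X Y : Finset V) : Prop :=
  ∀ p, ProperPath G X Y p → PossDirAlong G p → StartsVisible vis p

/-- Forbidden nodes: possible descendants of a node `w ∉ X` lying on a proper
possibly causal path from `X` to `Y`. -/
def Forb (G : PMG V) (X Y : Finset V) : Set V :=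
  { v | ∃ w, w ∉ X ∧
      (∃ p, ProperPath G X Y p ∧ PossDirAlong G p ∧ w ∈ p) ∧
      PossDescendant G w v }

/-- Forbidden nodes in a DAG or MAG: descendants of a node `w ∉ X` lying on a
proper causal path from `X` to `Y`. -/
def ForbD (G : PMG V) (X Y : Finset V) : Set V :=
  { v | ∃ w, w ∉ X ∧
      (∃ p, ProperPath G X Y p ∧ DirectedAlong G p ∧ w ∈ p) ∧
      Descendant G w v }

/-- The generalized adjustment criterion (GAC) relative to `(X,Y)`, with
visibility predicate `vis`. -/
def GAC (G : PMG V) (vis : V → V → Prop) (X Y Z : Finset V) : Prop :=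
  Amenable G vis X Y ∧
  (∀ z ∈ Z, z ∉ Forb G X Y) ∧
  (∀ p, ProperPath G X Y p → DefStatus G p → ¬ PossDirAlong G p → ¬ MConn G Z p)

/-- The adjustment criterion (AC) for DAGs and MAGs relative to `(X,Y)`, with
visibility predicate `vis`. -/
def AC (H : PMG V) (vis : V → V → Prop) (X Y Z : Finset V) : Prop :=
  (∀ p, ProperPath H X Y p → DirectedAlong H p → StartsVisible vis p) ∧
  (∀ z ∈ Z, z ∉ ForbD H X Y) ∧
  (∀ p, ProperPath H X Y p → ¬ PossDirAlong H p → ¬ MConn H Z p)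

/-- `cls` is the Markov equivalence class of DAGs represented by the CPDAG `G`. -/
def IsCPDAGOf (G : PMG V) (cls : Set (PMG V)) : Prop :=
  cls.Nonempty ∧
  (∀ D ∈ cls, IsDAG D) ∧
  (∀ D ∈ cls, ∀ D', IsDAG D' → MarkovEquiv D D' → D' ∈ cls) ∧
  (∀ D ∈ cls, ∀ D' ∈ cls, MarkovEquiv D D') ∧
  (∀ D ∈ cls, ∀ a b, G.Adj a b ↔ D.Adj a b) ∧
  (∀ a b, G.Adj a b → (G.DirEdge a b ∨ G.NondirEdge a b)) ∧
  (∀ a b, G.DirEdge a b ↔ (G.Adj a b ∧ ∀ D ∈ cls, D.DirEdge a b))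

/-- `cls` is the Markov equivalence class of MAGs represented by the PAG `P`. -/
def IsPAGOf (P : PMG V) (cls : Set (PMG V)) : Prop :=
  cls.Nonempty ∧
  (∀ M ∈ cls, IsMAG M) ∧
  (∀ M ∈ cls, ∀ M', IsMAG M' → MarkovEquiv M M' → M' ∈ cls) ∧
  (∀ M ∈ cls, ∀ M' ∈ cls, MarkovEquiv M M') ∧
  (∀ M ∈ cls, ∀ a b, P.Adj a b ↔ M.Adj a b) ∧
  (∀ a b, P.mark a b = some Mark.arrow ↔ (P.Adj a b ∧ ∀ M ∈ cls, M.mark a b = some Mark.arrow)) ∧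
  (∀ a b, P.mark a b = some Mark.tail ↔ (P.Adj a b ∧ ∀ M ∈ cls, M.mark a b = some Mark.tail))

section Density

variable {Ω : Type} [Fintype V] [DecidableEq V] [Fintype Ω]

/-- `f` is a probability density (pmf) over the joint state space. -/
def IsDensity (f : (V → Ω) → ℝ) : Prop :=
  (∀ v, 0 ≤ f v) ∧ ∑ v, f v = 1

/-- The marginal density of the variables in `S`, evaluated at `v`. -/
noncomputable def margOn (f : (V → Ω) → ℝ) (S : Finset V) (v : V → Ω) : ℝ :=
  ∑ w : V → Ω, if ∀ i ∈ S, w i = v i then f w else 0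

/-- The conditional density of the variables in `A` given those in `B`, at `v`. -/
noncomputable def condOn (f : (V → Ω) → ℝ) (A B : Finset V) (v : V → Ω) : ℝ :=
  margOn f (A ∪ B) v / margOn f B v

/-- The parents of `i` in `G`. -/
noncomputable def parents (G : PMG V) (i : V) : Finset V :=
  Finset.univ.filter (fun j => G.DirEdge j i)

/-- `f` factorizes according to the DAG `G`. -/
def ConsistentWith (G : PMG V) (f : (V → Ω) → ℝ) : Prop :=
  ∀ v, f v = ∏ i, condOn f {i} (parents G i) v

/-- The post-intervention density `f(· | do(X = xval))` (truncated factorization). -/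
noncomputable def doDens (G : PMG V) (f : (V → Ω) → ℝ) (X : Finset V) (xval : V → Ω) :
    (V → Ω) → ℝ :=
  fun v => if ∀ i ∈ X, v i = xval i then ∏ i ∈ Xᶜ, condOn f {i} (parents G i) v else 0

/-- Overwrite `v` on `Z` by the assignment `w`. -/
noncomputable def patch (Z : Finset V) (v : V → Ω) (w : {i // i ∈ Z} → Ω) : V → Ω :=
  fun i => if h : i ∈ Z then w ⟨i, h⟩ else v i

end Density

/-- `Z` is an adjustment set relative to `(X,Y)` in the DAG `D`: for every finite state
space and every density consistent with `D`, the adjustment formula holds. -/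
def IsAdjSetDAG [Fintype V] [DecidableEq V] (D : PMG V) (X Y Z : Finset V) : Prop :=
  ∀ (Ω : Type) [Fintype Ω] [DecidableEq Ω] (f : (V → Ω) → ℝ),
    IsDensity f → ConsistentWith D f →
    ∀ v : V → Ω,
      margOn (doDens D f X v) Y v =
        if Z = ∅ then condOn f Y X v
        else ∑ w : ({i // i ∈ Z} → Ω),
          condOn f Y (X ∪ Z) (patch Z v w) * margOn f Z (patch Z v w)

/-- The marginal of a density over `V ⊕ L` on the observed variables `V`. -/
noncomputable def obsMargin {L : Type} [Fintype V] [Fintype L] [DecidableEq V] [DecidableEq L]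
    {Ω : Type} [Fintype Ω] (f : ((V ⊕ L) → Ω) → ℝ) : (V → Ω) → ℝ :=
  fun v => ∑ w : (V ⊕ L) → Ω, if ∀ i : V, w (Sum.inl i) = v i then f w else 0

/-- `M` is the MAG over the observed variables `V` of the DAG `D'` over `V ⊕ L`. -/
def IsMAGOverObs {L : Type} (D' : PMG (V ⊕ L)) (M : PMG V) : Prop :=
  (∀ a b : V, M.Adj a b ↔ (a ≠ b ∧ ∀ S : Finset V, a ∉ S → b ∉ S →
      ¬ MSep D' (Sum.inl a) (Sum.inl b) (S.image Sum.inl))) ∧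
  (∀ a b : V, M.Adj a b →
    ((M.mark a b = some Mark.arrow ↔ ¬ Descendant D' (Sum.inl b) (Sum.inl a)) ∧
     (M.mark a b = some Mark.tail ↔ Descendant D' (Sum.inl b) (Sum.inl a))))

/-- `Z` is an adjustment set relative to `(X,Y)` in the MAG `M`: for every DAG `D'`
with latent variables whose MAG over `V` is `M` and every consistent density,
the adjustment formula holds for the observed margin. -/
def IsAdjSetMAG [Fintype V] [DecidableEq V] (M : PMG V) (X Y Z : Finset V) : Prop :=
  ∀ (Ω L : Type) [Fintype Ω] [DecidableEq Ω] [Fintype L] [DecidableEq L]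
    (D' : PMG (V ⊕ L)) (f' : ((V ⊕ L) → Ω) → ℝ),
    IsDAG D' → IsMAGOverObs D' M → IsDensity f' → ConsistentWith D' f' →
    ∀ v : (V ⊕ L) → Ω,
      margOn (obsMargin (doDens D' f' (X.image Sum.inl) v)) Y (fun i => v (Sum.inl i)) =
        if Z = ∅ then condOn (obsMargin f') Y X (fun i => v (Sum.inl i))
        else ∑ w : ({i // i ∈ Z} → Ω),
          condOn (obsMargin f') Y (X ∪ Z) (patch Z (fun i => v (Sum.inl i)) w) *
            margOn (obsMargin f') Z (patch Z (fun i => v (Sum.inl i)) w)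

/-- The distance-from-`Z` of a node `q`: the length of a shortest directed path
(possibly of length 0) from `q` to a member of `Z`. -/
noncomputable def distZ (G : PMG V) (Z : Finset V) (q : V) : ℕ :=
  sInf { n | ∃ p, IsPath G p ∧ DirectedAlong G p ∧ p.head? = some q ∧
      (∃ z ∈ Z, p.getLast? = some z) ∧ p.length = n + 1 }

/-- The distance-from-`Z` of a path `p`: the sum of the distances-from-`Z`
of the colliders on `p`. -/
noncomputable def pathDistZ (G : PMG V) (Z : Finset V) (p : List V) : ℕ :=
  ∑ i ∈ Finset.range p.length,
    if ColliderAt G p i then (p[i+1]?.elim 0 (distZ G Z)) else 0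

end PMG


/-! ## Auxiliary development -/

namespace PMGAux

open PMG Relation

variable {V : Type}

/-- Directed ancestor relation. -/
def Anc (G : PMG V) : V → V → Prop := ReflTransGen G.DirEdge

/-- Arrowhead at `y` on the edge `x, y`. -/
def I (G : PMG V) (x y : V) : Prop := G.mark x y = some Mark.arrow

theorem adj_symm {G : PMG V} {x y : V} (h : G.Adj x y) : G.Adj y x := (G.symm x y).1 h
theorem I.adj {G : PMG V} {x y : V} (h : I G x y) : G.Adj x y := by
  unfold I at h; simp [Adj, h]
theorem dir_adj {G : PMG V} {x y : V} (h : G.DirEdge x y) : G.Adj x y := by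
  simp [Adj, h.1]
theorem adj_ne {G : PMG V} {x y : V} (h : G.Adj x y) : x ≠ y := by
  rintro rfl; simp [Adj, G.irrefl] at h
theorem dir_I {G : PMG V} {x y : V} (h : G.DirEdge x y) : I G x y := h.1
theorem dir_not_I {G : PMG V} {x y : V} (h : G.DirEdge x y) : ¬ I G y x := by
  unfold I; rw [h.2]; simp
theorem bidir_symm {G : PMG V} {x y : V} (h : G.BidirEdge x y) : G.BidirEdge y x := ⟨h.2, h.1⟩
theorem bidir_adj {G : PMG V} {x y : V} (h : G.BidirEdge x y) : G.Adj x y := I.adj h.1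
theorem dir_not_bidir {G : PMG V} {x y : V} (h : G.DirEdge x y) : ¬ G.BidirEdge x y :=
  fun h' => dir_not_I h h'.2
theorem dir_not_bidir' {G : PMG V} {x y : V} (h : G.DirEdge x y) : ¬ G.BidirEdge y x :=
  fun h' => dir_not_I h h'.1
theorem dir_asymm {G : PMG V} {x y : V} (h : G.DirEdge x y) : ¬ G.DirEdge y x :=
  fun h' => dir_not_I h h'.1

/-- Ancestral graph, with ancestors given by the reflexive transitive closure. -/
structure AG (G : PMG V) : Prop where
  mixed : ∀ a b, G.Adj a b → G.DirEdge a b ∨ G.DirEdge b a ∨ G.BidirEdge a b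
  acyc : ∀ a b, Anc G a b → Anc G b a → a = b
  alm : ∀ a b, Anc G a b → ¬ G.BidirEdge b a

theorem AG.dir_of_not_I {G : PMG V} (h : AG G) {x y : V} (hxy : G.Adj x y) (hn : ¬ I G y x) :
    G.DirEdge x y := by
  rcases h.mixed x y hxy with h1 | h1 | h1
  · exact h1
  · exact absurd h1.1 hn
  · exact absurd h1.2 hn

theorem AG.bidir_of {G : PMG V} {x y : V} (h1 : I G x y) (h2 : I G y x) :
    G.BidirEdge x y := ⟨h1, h2⟩

theorem AG.I_or {G : PMG V} (h : AG G) {x y : V} (hx : I G x y) :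
    G.DirEdge x y ∨ G.BidirEdge x y := by
  by_cases h2 : I G y x
  · exact Or.inr ⟨hx, h2⟩
  · exact Or.inl (h.dir_of_not_I hx.adj h2)

theorem AG.not_anc_of_I {G : PMG V} (h : AG G) {x y : V} (hx : I G x y) : ¬ Anc G y x := by
  intro ha
  rcases h.I_or hx with h1 | h1
  · exact adj_ne hx.adj (h.acyc _ _ (.single h1) ha)
  · exact h.alm _ _ ha h1

theorem AG.I_trans {G : PMG V} (h : AG G) {x y z : V} (hx : I G x y) (hy : Anc G y z)
    (ha : G.Adj x z) : I G x z := by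
  by_contra hn
  have := h.dir_of_not_I (adj_symm ha) hn
  exact h.not_anc_of_I hx (hy.tail this)

theorem AG.D_trans {G : PMG V} (h : AG G) {x y z : V} (hx : Anc G x y) (hy : Anc G y z)
    (ha : G.Adj x z) : G.DirEdge x z := by
  apply h.dir_of_not_I ha
  intro hi
  exact h.not_anc_of_I hi (hx.trans hy)

/-! ### Active walks -/

/-- local activity condition at `y`. -/
def Ok (G : PMG V) (S T : Set V) (x y z : V) : Prop :=
  ((I G x y ∧ I G z y) → y ∈ T) ∧ (¬ (I G x y ∧ I G z y) → y ∉ S)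

theorem Ok.symm {G : PMG V} {S T : Set V} {x y z : V} (h : Ok G S T x y z) : Ok G S T z y x := by
  unfold Ok at *; rwa [and_comm (a := I G z y)]

/-- Active walks. -/
def Act (G : PMG V) (S T : Set V) : List V → Prop
  | x :: y :: l => G.Adj x y ∧ (∀ z, l.head? = some z → Ok G S T x y z) ∧ Act G S T (y :: l)
  | _ => True

theorem act_zip {G : PMG V} {S T : Set V} (L : List V) : ∀ (y : V) (R : List V),
    Act G S T (L.reverse ++ y :: R) ↔ Act G S T (y :: L) ∧ Act G S T (y :: R) ∧
      ∀ x z, L.head? = some x → R.head? = some z → Ok G S T x y z := by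
  induction L with
  | nil => intro y R; simp [Act]
  | cons x L ih =>
    intro y R
    rw [List.reverse_cons, List.append_assoc, List.singleton_append, ih]
    simp only [Act, List.head?_cons, Option.some.injEq]
    constructor
    · rintro ⟨h1, ⟨h2, h3, h4⟩, h5⟩
      refine ⟨⟨adj_symm h2, fun z hz => (h5 z y hz rfl).symm, h1⟩, h4, ?_⟩
      rintro _ z rfl hz
      exact h3 z hz
    · rintro ⟨⟨h1, h2, h3⟩, h4, h5⟩
      refine ⟨h3, ⟨adj_symm h1, fun z hz => h5 x z rfl hz, h4⟩, ?_⟩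
      rintro w _ hw rfl
      exact (h2 w hw).symm

theorem act_rev {G : PMG V} {S T : Set V} (l : List V) (h : Act G S T l) :
    Act G S T l.reverse := by
  cases l with
  | nil => exact h
  | cons x l =>
    rw [List.reverse_cons, act_zip]
    refine ⟨h, trivial, ?_⟩
    simp

theorem act_suffix {G : PMG V} {S T : Set V} (A l : List V) (h : Act G S T (A ++ l)) :
    Act G S T l := by
  induction A with
  | nil => exact h
  | cons x A ih =>
    apply ih
    cases hA : A ++ l with
    | nil => trivial
    | cons y l' => rw [List.cons_append, hA] at h; exact h.2.2

theorem act_congr {G G' : PMG V} {S T T' : Set V} : ∀ (l : List V),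
    (∀ u ∈ l, ∀ w ∈ l, G.mark u w = G'.mark u w) → (∀ y ∈ l, y ∈ T → y ∈ T') →
    Act G S T l → Act G' S T' l
  | [], _, _, _ => trivial
  | [_], _, _, _ => trivial
  | x :: y :: l, hm, hT, h => by
    refine ⟨?_, ?_, act_congr (y :: l) (fun u hu w hw => hm u (List.mem_cons_of_mem _ hu) w
      (List.mem_cons_of_mem _ hw)) (fun u hu => hT u (List.mem_cons_of_mem _ hu)) h.2.2⟩
    · have := h.1; unfold Adj at *; rwa [← hm x (by simp) y (by simp)]
    · intro z hz
      have hzl : z ∈ l := List.mem_of_mem_head? hz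
      have := h.2.1 z hz
      unfold Ok I at *
      rw [← hm x (by simp) y (by simp), ← hm z (by simp [hzl]) y (by simp)]
      exact ⟨fun h' => hT y (by simp) (this.1 h'), this.2⟩

/-- Set of ancestors of `S`. -/
def AnS (G : PMG V) (S : Set V) : Set V := {y | ∃ z ∈ S, Anc G y z}

theorem follow {G : PMG V} (hG : AG G) {S : Set V} (w : V) : ∀ (B : List V) (v : V),
    Act G S (AnS G S) (v :: (B ++ [w])) → (∀ y, (B ++ [w]).head? = some y → G.DirEdge v y) →
    v ∈ AnS G S ∨ ∃ q, (v :: B).getLast? = some q ∧ I G q w := by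
  intro B
  induction B with
  | nil => intro v h hd; right; exact ⟨v, rfl, (hd w rfl).1⟩
  | cons y B ih =>
    intro v h hd
    have hvy := hd y rfl
    obtain ⟨n, hn⟩ : ∃ n, (B ++ [w]).head? = some n := by cases B <;> simp
    have hok := h.2.1 n hn
    by_cases hc : I G n y
    · left
      obtain ⟨z, hz, hyz⟩ := hok.1 ⟨hvy.1, hc⟩
      exact ⟨z, hz, hyz.head hvy⟩
    · have hyn : G.Adj y n := by
        cases hB : B ++ [w] with
        | nil => simp at hB
        | cons n' l =>
          have h2 : Act G S (AnS G S) (y :: (B ++ [w])) := h.2.2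
          rw [hB] at hn h2; simp at hn; subst hn; exact h2.1
      rcases ih y h.2.2 (fun y' hy' => by
        rw [hn] at hy'; cases hy'; exact hG.dir_of_not_I hyn hc) with ⟨z, hz, hyz⟩ | ⟨q, hq, hI⟩
      · left; exact ⟨z, hz, hyz.head hvy⟩
      · right; exact ⟨q, by rw [List.getLast?_cons_cons]; exact hq, hI⟩

theorem dup_split : ∀ (l : List V), ¬ l.Nodup → ∃ A v B C, l = A ++ v :: (B ++ v :: C) := by
  intro l
  induction l with
  | nil => intro h; simp at h
  | cons x l ih =>
    intro h
    by_cases hx : x ∈ l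
    · obtain ⟨B, C, rfl⟩ := List.append_of_mem hx
      exact ⟨[], x, B, C, rfl⟩
    · have : ¬ l.Nodup := fun h' => h (List.nodup_cons.2 ⟨hx, h'⟩)
      obtain ⟨A, v, B, C, rfl⟩ := ih this
      exact ⟨x :: A, v, B, C, rfl⟩

theorem act_cut {G : PMG V} (hG : AG G) {S : Set V} (A : List V) (v : V) (B C : List V)
    (h : Act G S (AnS G S) (A ++ v :: (B ++ v :: C))) : Act G S (AnS G S) (A ++ v :: C) := by
  obtain ⟨L, rfl⟩ : ∃ L, A = List.reverse L := ⟨A.reverse, by simp⟩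
  rw [act_zip] at h ⊢
  obtain ⟨h1, h2, h3⟩ := h
  obtain ⟨K, hK⟩ : ∃ K, v :: B = List.reverse K := ⟨(v :: B).reverse, by simp⟩
  have h2' := h2
  rw [← List.cons_append, hK, act_zip] at h2'
  obtain ⟨h4, h5, h6⟩ := h2'
  refine ⟨h1, h5, ?_⟩
  intro x z hx hz
  obtain ⟨p, hp⟩ : ∃ p, (B ++ v :: C).head? = some p := by cases B <;> simp
  obtain ⟨q, hq⟩ : ∃ q, (v :: B).getLast? = some q := by
    cases hh : (v :: B).getLast? with
    | none => simp at hh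
    | some q => exact ⟨q, rfl⟩
  have hq' : K.head? = some q := by rw [hK] at hq; simpa using hq
  have ok1 := h3 x p hx hp
  have ok2 := h6 q z hq' hz
  constructor
  · rintro ⟨ix, iz⟩
    by_cases ip : I G p v
    · exact ok1.1 ⟨ix, ip⟩
    by_cases iq : I G q v
    · exact ok2.1 ⟨iq, iz⟩
    have hvp : G.Adj v p := by
      cases hB : B ++ v :: C with
      | nil => simp at hB
      | cons n' l =>
        rw [hB] at hp h2; simp at hp; subst hp; exact h2.1
    have h7 : Act G S (AnS G S) (v :: (B ++ [v])) := by
      have := act_rev _ h4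
      rw [List.reverse_cons, ← hK] at this
      exact this
    have hp' : (B ++ [v]).head? = some p := by cases B <;> simpa using hp
    rcases follow hG v B v h7 (fun y hy => by
      rw [hp'] at hy; cases hy; exact hG.dir_of_not_I hvp ip) with h8 | ⟨q', hq1, hI⟩
    · exact h8
    · rw [hq] at hq1; cases hq1; exact absurd hI iq
  · intro hn
    by_cases ix : I G x v
    · have : ¬ I G z v := fun hz => hn ⟨ix, hz⟩
      exact ok2.2 (fun h => this h.2)
    · exact ok1.2 (fun h => ix h.1)

theorem act_nodup {G : PMG V} (hG : AG G) {S : Set V} : ∀ (n : ℕ) (l : List V), l.length = n →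
    Act G S (AnS G S) l → ∃ l', l'.Nodup ∧ Act G S (AnS G S) l' ∧ l'.head? = l.head? ∧
      l'.getLast? = l.getLast? := by
  intro n
  induction n using Nat.strong_induction_on with
  | _ n ih =>
    intro l hl h
    by_cases hn : l.Nodup
    · exact ⟨l, hn, h, rfl, rfl⟩
    · obtain ⟨A, v, B, C, rfl⟩ := dup_split l hn
      obtain ⟨l', h1, h2, h3, h4⟩ := ih (A ++ v :: C).length (by rw [← hl]; simp)
        _ rfl (act_cut hG A v B C h)
      refine ⟨l', h1, h2, h3.trans ?_, h4.trans ?_⟩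
      · cases A <;> simp
      · have : A ++ v :: (B ++ v :: C) = (A ++ v :: B) ++ v :: C := by simp
        rw [this, List.getLast?_append_of_ne_nil _ (by simp),
          List.getLast?_append_of_ne_nil _ (by simp)]

end PMGAux

namespace PMGAux

open PMG Relation

variable {V : Type}

/-! ### Lists and relations -/

theorem chain_iff {r : V → V → Prop} : ∀ (p : List V),
    p.IsChain r ↔ ∀ i a b, p[i]? = some a → p[i+1]? = some b → r a b
  | [] => by simp
  | [x] => by simp
  | x :: y :: l => by
    rw [List.isChain_cons_cons, chain_iff (y :: l)]
    constructor
    · rintro ⟨h1, h2⟩ i a b ha hb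
      cases i with
      | zero => simp at ha hb; subst ha hb; exact h1
      | succ i => exact h2 i a b (by simpa using ha) (by simpa using hb)
    · intro h
      exact ⟨h 0 x y rfl rfl, fun i a b ha hb => h (i+1) a b (by simpa using ha) (by simpa using hb)⟩

theorem rtg_list {r : V → V → Prop} {a b : V} (h : ReflTransGen r a b) :
    ∃ l : List V, (a :: l).Nodup ∧ (a :: l).IsChain r ∧ (a :: l).getLast? = some b := by
  induction h using ReflTransGen.head_induction_on with
  | refl => exact ⟨[], by simp⟩
  | head h1 h2 ih =>
    rename_i a c
    obtain ⟨l, hn, hc, hl⟩ := ih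
    by_cases ha : a ∈ c :: l
    · obtain ⟨A, B, hAB⟩ := List.append_of_mem ha
      rw [hAB] at hn hc hl
      refine ⟨B, (List.nodup_append.1 hn).2.1, hc.right_of_append, ?_⟩
      rw [List.getLast?_append_of_ne_nil _ (by simp)] at hl
      exact hl
    · refine ⟨c :: l, List.nodup_cons.2 ⟨ha, hn⟩, List.isChain_cons_cons.2 ⟨h1, hc⟩, ?_⟩
      rw [List.getLast?_cons_cons]; exact hl

theorem list_rtg {r : V → V → Prop} {b : V} : ∀ (l : List V) (a : V), (a :: l).IsChain r →
    (a :: l).getLast? = some b → ReflTransGen r a b := by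
  intro l
  induction l with
  | nil => intro a _ h; simp at h; subst h; exact .refl
  | cons c l ih =>
    intro a h1 h2
    rw [List.isChain_cons_cons] at h1
    rw [List.getLast?_cons_cons] at h2
    exact (ih c h1.2 h2).head h1.1

theorem directedAlong_iff {G : PMG V} {p : List V} : DirectedAlong G p ↔ p.IsChain G.DirEdge :=
  (chain_iff p).symm

theorem head_cons {p : List V} {a : V} (h : p.head? = some a) : ∃ l, p = a :: l := by
  cases p with
  | nil => simp at h
  | cons x l => simp at h; subst h; exact ⟨l, rfl⟩

theorem desc_iff {G : PMG V} {a b : V} : Descendant G a b ↔ Anc G a b := by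
  constructor
  · rintro ⟨p, _, h2, h3, h4⟩
    obtain ⟨l, rfl⟩ := head_cons h3
    exact list_rtg l a (directedAlong_iff.1 h2) h4
  · intro h
    obtain ⟨l, h1, h2, h3⟩ := rtg_list h
    exact ⟨a :: l, ⟨by simp, h1, h2.imp (fun _ _ h => dir_adj h)⟩, directedAlong_iff.2 h2, rfl, h3⟩

theorem ag_iff {G : PMG V} : IsAncestral G ↔ AG G := by
  constructor
  · rintro ⟨h1, h2, h3⟩
    exact ⟨h1, fun a b ha hb => h2 a b (desc_iff.2 ha) (desc_iff.2 hb),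
      fun a b ha => h3 a b (desc_iff.2 ha)⟩
  · rintro ⟨h1, h2, h3⟩
    exact ⟨h1, fun a b ha hb => h2 a b (desc_iff.1 ha) (desc_iff.1 hb),
      fun a b ha => h3 a b (desc_iff.1 ha)⟩

/-! ### Connection -/

/-- active walk between `v` and `d`. -/
def Conn (G : PMG V) (S : Set V) (d v : V) : Prop :=
  ∃ L, Act G S (AnS G S) (v :: L) ∧ (v :: L).getLast? = some d

/-- active walk between `v` and `d`, into `v`. -/
def ConnI (G : PMG V) (S : Set V) (d v : V) : Prop :=
  ∃ x L, Act G S (AnS G S) (v :: x :: L) ∧ I G x v ∧ (v :: x :: L).getLast? = some d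

theorem ConnI.conn {G : PMG V} {S : Set V} {d v : V} (h : ConnI G S d v) : Conn G S d v := by
  obtain ⟨x, L, h1, _, h2⟩ := h; exact ⟨_, h1, h2⟩

theorem conn_glue {G : PMG V} {S : Set V} {v d b : V} {L R : List V}
    (h1 : Act G S (AnS G S) (v :: L)) (h2 : (v :: L).getLast? = some d)
    (h3 : Act G S (AnS G S) (v :: R)) (h4 : (v :: R).getLast? = some b)
    (h : ∀ x z, L.head? = some x → R.head? = some z → Ok G S (AnS G S) x v z) : Conn G S b d := by
  have h5 := (act_zip L v R).2 ⟨h1, h3, h⟩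
  have h6 : (L.reverse ++ v :: R).head? = some d := by
    have : L.reverse ++ v :: R = (v :: L).reverse ++ R := by simp
    rw [this, List.head?_append_of_ne_nil _ (by simp), List.head?_reverse, h2]
  obtain ⟨l, hl⟩ := head_cons h6
  refine ⟨l, hl ▸ h5, ?_⟩
  rw [← hl, List.getLast?_append_of_ne_nil _ (by simp), h4]

theorem conn_symm {G : PMG V} {S : Set V} {d v : V} (h : Conn G S d v) : Conn G S v d := by
  obtain ⟨L, h1, h2⟩ := h
  exact conn_glue (R := []) h1 h2 trivial (by simp) (by simp)

theorem conn_join {G : PMG V} {S : Set V} {d b v : V} (h1 : Conn G S d v) (h2 : Conn G S b v)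
    (h3 : v ∉ S) (h4 : v ∈ AnS G S) : Conn G S b d := by
  obtain ⟨L, a1, a2⟩ := h1
  obtain ⟨R, b1, b2⟩ := h2
  exact conn_glue a1 a2 b1 b2 (fun _ _ _ _ => ⟨fun _ => h4, fun _ => h3⟩)

theorem conn_step_out {G : PMG V} {S : Set V} {d v w : V} (h1 : Conn G S d v) (h3 : v ∉ S)
    (h4 : G.DirEdge v w) : ConnI G S d w := by
  obtain ⟨L, a1, a2⟩ := h1
  refine ⟨v, L, ⟨adj_symm (dir_adj h4), fun z _ => ⟨fun h => absurd h.1 (dir_not_I h4),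
    fun _ => h3⟩, a1⟩, h4.1, ?_⟩
  rw [List.getLast?_cons_cons]; exact a2

theorem connI_coll {G : PMG V} {S : Set V} {d v w : V} (h1 : ConnI G S d v) (h3 : v ∈ AnS G S)
    (h4 : G.BidirEdge v w) : ConnI G S d w := by
  obtain ⟨x, L, a1, a2, a3⟩ := h1
  refine ⟨v, x :: L, ⟨adj_symm (bidir_adj h4), fun z hz => ?_, a1⟩, h4.1, ?_⟩
  · simp at hz; subst hz
    exact ⟨fun _ => h3, fun h => absurd ⟨h4.2, a2⟩ h⟩
  · rw [List.getLast?_cons_cons]; exact a3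

theorem sub_AnS {G : PMG V} {S : Set V} {v : V} (h : v ∈ S) : v ∈ AnS G S := ⟨v, h, .refl⟩

theorem AnS_up {G : PMG V} {S : Set V} {v w : V} (h : Anc G v w) (hw : w ∈ AnS G S) :
    v ∈ AnS G S := by
  obtain ⟨z, hz, h'⟩ := hw; exact ⟨z, hz, h.trans h'⟩

theorem conn_down {G : PMG V} {S : Set V} {d v w : V} (h1 : Conn G S d v) (h2 : v ∉ AnS G S)
    (h3 : Anc G v w) : Conn G S d w := by
  induction h3 using ReflTransGen.head_induction_on with
  | refl => exact h1
  | head h4 h5 ih =>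
    refine ih (conn_step_out h1 (fun h => h2 (sub_AnS h)) h4).conn (fun h => h2 (AnS_up (.single h4) h))

theorem conn_adj {G : PMG V} {S : Set V} {d v : V} (h : G.Adj d v) : Conn G S d v :=
  ⟨[d], ⟨adj_symm h, by simp, trivial⟩, by simp⟩

theorem connI_I {G : PMG V} {S : Set V} {d v : V} (h : I G d v) : ConnI G S d v :=
  ⟨d, [], ⟨adj_symm h.adj, by simp, trivial⟩, h, by simp⟩

/-! ### Connection and m-separation -/

theorem act_iff {G : PMG V} {S T : Set V} : ∀ (l : List V), Act G S T l ↔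
    l.IsChain G.Adj ∧ ∀ i x y z, l[i]? = some x → l[i+1]? = some y → l[i+2]? = some z →
      Ok G S T x y z
  | [] => by simp [Act]
  | [x] => by simp [Act]
  | x :: y :: l => by
    rw [List.isChain_cons_cons]
    show (_ ∧ _ ∧ _) ↔ _
    rw [act_iff (y :: l)]
    constructor
    · rintro ⟨h1, h2, h3, h4⟩
      refine ⟨⟨h1, h3⟩, ?_⟩
      intro i a b c ha hb hc
      cases i with
      | zero =>
        simp at ha hb; subst ha hb
        apply h2
        cases l <;> simpa using hc
      | succ i => exact h4 i a b c (by simpa using ha) (by simpa using hb) (by simpa using hc)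
    · rintro ⟨⟨h1, h3⟩, h4⟩
      refine ⟨h1, ?_, h3, fun i a b c ha hb hc =>
        h4 (i+1) a b c (by simpa using ha) (by simpa using hb) (by simpa using hc)⟩
      intro z hz
      exact h4 0 x y z rfl rfl (by cases l <;> simpa using hz)

theorem mconn_iff {G : PMG V} (hG : AG G) {Z : Finset V} {p : List V} (hp : p.IsChain G.Adj) :
    MConn G Z p ↔ Act G (Z : Set V) (AnS G (Z : Set V)) p := by
  have key : ∀ i a b c, p[i]? = some a → p[i+1]? = some b → p[i+2]? = some c →
      (ColliderAt G p i ↔ I G a b ∧ I G c b) ∧ (DefNonColliderAt G p i ↔ ¬ (I G a b ∧ I G c b)) := by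
    intro i a b c ha hb hc
    have h1 := (chain_iff p).1 hp i a b ha hb
    have h2 := (chain_iff p).1 hp (i+1) b c hb hc
    have m1 : G.mark a b = some Mark.tail ∨ G.mark a b = some Mark.arrow := by
      rcases hG.mixed a b h1 with h | h | h
      · exact Or.inr h.1
      · exact Or.inl h.2
      · exact Or.inr h.1
    have m2 : G.mark c b = some Mark.tail ∨ G.mark c b = some Mark.arrow := by
      rcases hG.mixed b c h2 with h | h | h
      · exact Or.inl h.2
      · exact Or.inr h.1
      · exact Or.inr h.2
    constructor
    · constructor
      · rintro ⟨a', b', c', ha', hb', hc', h⟩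
        rw [ha] at ha'; rw [hb] at hb'; rw [hc] at hc'
        cases ha'; cases hb'; cases hc'; exact h
      · intro h; exact ⟨a, b, c, ha, hb, hc, h⟩
    · constructor
      · rintro ⟨a', b', c', ha', hb', hc', h⟩
        rw [ha] at ha'; rw [hb] at hb'; rw [hc] at hc'
        cases ha'; cases hb'; cases hc'
        unfold I
        rintro ⟨e1, e2⟩
        rw [e1, e2] at h; simp at h
      · intro h
        refine ⟨a, b, c, ha, hb, hc, ?_⟩
        unfold I at h
        rcases m1 with m1 | m1
        · exact Or.inl m1
        rcases m2 with m2 | m2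
        · exact Or.inr (Or.inl m2)
        exact absurd ⟨m1, m2⟩ h
  rw [act_iff]
  constructor
  · rintro ⟨_, h1, h2⟩
    refine ⟨hp, fun i a b c ha hb hc => ?_⟩
    obtain ⟨k1, k2⟩ := key i a b c ha hb hc
    refine ⟨fun h => ?_, fun h => h1 i b hb (k2.2 h)⟩
    obtain ⟨z, hz, hd⟩ := h2 i b hb (k1.2 h)
    exact ⟨z, hz, desc_iff.1 hd⟩
  · rintro ⟨_, h⟩
    refine ⟨fun i hi => ?_, ?_, ?_⟩
    · obtain ⟨k1, k2⟩ := key i p[i] p[i+1] p[i+2] (by simp) (by simp) (by simp)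
      rw [k1, k2]; exact em _
    · intro i b hb hd
      obtain ⟨a, b', c, ha, hb', hc, h'⟩ := id hd
      rw [hb] at hb'; cases hb'
      exact (h i a b c ha hb hc).2 ((key i a b c ha hb hc).2.1 hd)
    · intro i b hb hd
      obtain ⟨a, b', c, ha, hb', hc, h'⟩ := id hd
      rw [hb] at hb'; cases hb'
      obtain ⟨z, hz, h2⟩ := (h i a b c ha hb hc).1 ((key i a b c ha hb hc).1.1 hd)
      exact ⟨z, hz, desc_iff.2 h2⟩

theorem msep_iff {G : PMG V} (hG : AG G) {Z : Finset V} {a b : V} (hab : a ≠ b) :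
    MSep G a b Z ↔ ¬ Conn G (Z : Set V) b a := by
  constructor
  · rintro h ⟨L, h1, h2⟩
    obtain ⟨l, h3, h4, h5, h6⟩ := act_nodup hG _ _ rfl h1
    have hc := ((act_iff l).1 h4).1
    have hne : l ≠ [] := by rintro rfl; simp at h5
    refine h l ⟨⟨hne, h3, hc⟩, by simpa using h5, h6.trans h2, ?_⟩ ((mconn_iff hG hc).2 h4)
    obtain ⟨l', rfl⟩ := head_cons (h5.trans rfl)
    cases l' with
    | nil => rw [h2] at h6; simp at h6; exact absurd h6 hab
    | cons y l => simp
  · intro h p ⟨⟨_, _, hc⟩, h1, h2, _⟩ hm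
    obtain ⟨l, rfl⟩ := head_cons h1
    exact h ⟨l, (mconn_iff hG hc).1 hm, h2⟩

/-- Equality of connection relations. -/
def Eqv (G H : PMG V) : Prop :=
  ∀ (S : Finset V) a b, a ≠ b → a ∉ S → b ∉ S → (Conn G (S : Set V) a b ↔ Conn H (S : Set V) a b)

theorem eqv_iff {G H : PMG V} (hG : AG G) (hH : AG H) : MarkovEquiv G H ↔ Eqv G H := by
  constructor
  · intro h S a b hab ha hb
    have := h b a S hab.symm hb ha
    rw [msep_iff hG hab.symm, msep_iff hH hab.symm] at this
    exact not_iff_not.1 this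
  · intro h a b S hab ha hb
    rw [msep_iff hG hab, msep_iff hH hab, h S b a hab.symm hb ha]

/-- MAG in terms of connection. -/
theorem mag_iff {G : PMG V} : IsMAG G ↔ AG G ∧ ∀ a b : V, a ≠ b → ¬ G.Adj a b →
    ∃ Z : Finset V, a ∉ Z ∧ b ∉ Z ∧ ¬ Conn G (Z : Set V) a b := by
  unfold IsMAG
  rw [ag_iff]
  constructor
  · rintro ⟨hG, h⟩
    refine ⟨hG, fun a b hab hn => ?_⟩
    obtain ⟨Z, h1, h2, h3⟩ := h b a hab.symm (fun h => hn (adj_symm h))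
    exact ⟨Z, h2, h1, (msep_iff hG hab.symm).1 h3⟩
  · rintro ⟨hG, h⟩
    refine ⟨hG, fun a b hab hn => ?_⟩
    obtain ⟨Z, h1, h2, h3⟩ := h b a hab.symm (fun h => hn (adj_symm h))
    exact ⟨Z, h2, h1, (msep_iff hG hab).2 h3⟩

/-- transfer of MAGness along equivalence with the same adjacencies -/
theorem mag_transfer {G H : PMG V} (hG : IsMAG G) (hH : AG H) (he : Eqv G H)
    (ha : ∀ a b, G.Adj a b ↔ H.Adj a b) : IsMAG H := by
  rw [mag_iff] at *
  refine ⟨hH, fun a b hab hn => ?_⟩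
  obtain ⟨Z, h1, h2, h3⟩ := hG.2 a b hab (fun h => hn ((ha a b).1 h))
  exact ⟨Z, h1, h2, fun h => h3 ((he Z a b hab h1 h2).2 h)⟩

/-- invariance of unshielded colliders -/
theorem unshielded {M M2 : PMG V} (hM : IsMAG M) (hM2 : IsMAG M2) (he : Eqv M M2)
    (hadj : ∀ a b, M.Adj a b ↔ M2.Adj a b) {x y z : V} (hxz : x ≠ z) (hn : ¬ M.Adj x z)
    (h1 : I M x y) (h2 : I M z y) : I M2 x y ∧ I M2 z y := by
  rw [mag_iff] at hM hM2
  obtain ⟨S, hx, hz, hs⟩ := hM.2 x z hxz hn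
  have hy : y ∉ S := by
    intro hy
    apply hs
    exact ⟨[y, x], ⟨I.adj h2, by
      intro w hw; simp at hw; subst hw
      exact ⟨fun _ => sub_AnS (by simpa using hy), fun h => absurd ⟨h2, h1⟩ h⟩,
      adj_symm (I.adj h1), by simp, trivial⟩, by simp⟩
  by_contra hcon
  apply hs
  rw [he S x z hxz hx hz]
  refine ⟨[y, x], ⟨(hadj _ _).1 (I.adj h2), ?_,
      (hadj _ _).1 (adj_symm (I.adj h1)), by simp, trivial⟩, by simp⟩
  · intro w hw; simp at hw; subst hw
    exact ⟨fun h => absurd ⟨h.2, h.1⟩ hcon, fun _ => by simpa using hy⟩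

end PMGAux

namespace PMGAux

open PMG Relation

variable {V : Type}

/-! ### Turning one arrowhead of a bidirected edge into a tail -/

/-- `M'` arises from `M` by turning `a ↔ b` into `a → b`. -/
structure Tl (M M' : PMG V) (a b : V) : Prop where
  bid : M.BidirEdge a b
  dir : M'.DirEdge a b
  eq : ∀ x y, ¬ (x = b ∧ y = a) → M'.mark x y = M.mark x y

/-- change a single mark -/
noncomputable def setMark (G : PMG V) (a b : V) (h : G.Adj a b) (m : Mark) : PMG V where
  mark x y := if x = a ∧ y = b then some m else G.mark x y
  symm := by
    intro x y
    by_cases h1 : x = a ∧ y = b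
    · obtain ⟨rfl, rfl⟩ := h1
      have hne := adj_ne h
      have h2 : G.Adj y x := adj_symm h
      simp only [and_self, if_true]
      rw [if_neg (fun h => hne h.2)]
      simpa [Adj] using h2
    · by_cases h2 : y = a ∧ x = b
      · obtain ⟨rfl, rfl⟩ := h2
        have h2 : G.Adj x y := adj_symm h
        rw [if_neg h1, if_pos ⟨rfl, rfl⟩]
        simpa [Adj] using h2
      · rw [if_neg h1, if_neg h2]; exact G.symm x y
  irrefl := by
    intro x
    have hne := adj_ne h
    rw [if_neg (by rintro ⟨rfl, rfl⟩; exact hne rfl)]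
    exact G.irrefl x

theorem exists_Tl {M : PMG V} {a b : V} (h : M.BidirEdge a b) : ∃ M', Tl M M' a b := by
  have hne := adj_ne (bidir_adj h)
  refine ⟨setMark M b a (adj_symm (bidir_adj h)) Mark.tail, h, ⟨?_, ?_⟩, ?_⟩
  · show (if a = b ∧ b = a then _ else _) = _
    rw [if_neg (fun h => hne h.1)]; exact h.1
  · show (if b = b ∧ a = a then _ else _) = _
    simp
  · intro x y hxy
    show (if x = b ∧ y = a then _ else _) = _
    rw [if_neg hxy]

theorem exists_Tl' {M : PMG V} {a b : V} (h : M.DirEdge a b) : ∃ M', Tl M' M a b := by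
  have hne := adj_ne (dir_adj h)
  refine ⟨setMark M b a (adj_symm (dir_adj h)) Mark.arrow, ⟨?_, ?_⟩, h, ?_⟩
  · show (if a = b ∧ b = a then _ else _) = _
    rw [if_neg (fun h => hne h.1)]; exact h.1
  · show (if b = b ∧ a = a then _ else _) = _
    simp
  · intro x y hxy
    show _ = (if x = b ∧ y = a then _ else _)
    rw [if_neg hxy]

section TlFacts

variable {M M' : PMG V} {a b : V} (t : Tl M M' a b)

include t

theorem Tl.ne : a ≠ b := adj_ne (bidir_adj t.bid)

theorem Tl.adj (x y : V) : M'.Adj x y ↔ M.Adj x y := by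
  by_cases h : x = b ∧ y = a
  · obtain ⟨rfl, rfl⟩ := h
    exact iff_of_true (adj_symm (dir_adj t.dir)) (adj_symm (bidir_adj t.bid))
  · unfold Adj; rw [t.eq x y h]

theorem Tl.I_iff (x y : V) : I M' x y ↔ I M x y ∧ ¬ (x = b ∧ y = a) := by
  by_cases h : x = b ∧ y = a
  · obtain ⟨rfl, rfl⟩ := h
    simp [dir_not_I t.dir]
  · unfold I; rw [t.eq x y h]; simp [h]

theorem Tl.D_iff (x y : V) : M'.DirEdge x y ↔ M.DirEdge x y ∨ (x = a ∧ y = b) := by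
  by_cases h : x = b ∧ y = a
  · obtain ⟨rfl, rfl⟩ := h
    refine iff_of_false (dir_asymm t.dir) ?_
    rintro (h | h)
    · exact dir_not_bidir' h t.bid
    · exact t.ne h.2
  · by_cases h2 : y = b ∧ x = a
    · obtain ⟨rfl, rfl⟩ := h2
      exact iff_of_true t.dir (Or.inr ⟨rfl, rfl⟩)
    · unfold DirEdge
      rw [t.eq x y h, t.eq y x h2]
      constructor
      · exact Or.inl
      · rintro (h3 | h3)
        · exact h3
        · exact absurd ⟨h3.2, h3.1⟩ h2

theorem Tl.D (x y : V) (h : M.DirEdge x y) : M'.DirEdge x y := (t.D_iff x y).2 (Or.inl h)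

theorem Tl.B_iff (x y : V) : M'.BidirEdge x y ↔
    M.BidirEdge x y ∧ ¬ (x = b ∧ y = a) ∧ ¬ (x = a ∧ y = b) := by
  have h1 := t.I_iff x y
  have h2 := t.I_iff y x
  show (I M' x y ∧ I M' y x) ↔ (I M x y ∧ I M y x) ∧ _
  rw [h1, h2]
  tauto

theorem Tl.anc {x y : V} (h : Anc M x y) : Anc M' x y :=
  ReflTransGen.mono (fun x y h => t.D x y h) _ _ h

theorem Tl.anc_inv {x y : V} (h : Anc M' x y) : Anc M x y ∨ (Anc M x a ∧ Anc M b y) := by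
  induction h with
  | refl => exact Or.inl .refl
  | tail h1 h2 ih =>
    rcases (t.D_iff _ _).1 h2 with h3 | ⟨rfl, rfl⟩
    · rcases ih with ih | ih
      · exact Or.inl (ih.tail h3)
      · exact Or.inr ⟨ih.1, ih.2.tail h3⟩
    · rcases ih with ih | ih
      · exact Or.inr ⟨ih, .refl⟩
      · exact Or.inr ⟨ih.1, .refl⟩

theorem Tl.ag (hM : AG M)
    (hiv : ∀ x y, Anc M x a → Anc M b y → M.BidirEdge x y → x = a ∧ y = b) : AG M' := by
  have hba : ¬ Anc M b a := fun h => hM.alm _ _ h t.bid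
  refine ⟨?_, ?_, ?_⟩
  · intro x y h
    have h1 := t.B_iff x y
    have h2 := t.D_iff x y
    have h3 := t.D_iff y x
    rcases hM.mixed x y ((t.adj x y).1 h) with h | h | h <;> tauto
  · intro p q h1 h2
    rcases t.anc_inv h1 with h1 | h1 <;> rcases t.anc_inv h2 with h2 | h2
    · exact hM.acyc _ _ h1 h2
    · exact absurd (h2.2.trans (h1.trans h2.1)) hba
    · exact absurd (h1.2.trans (h2.trans h1.1)) hba
    · exact absurd (h1.2.trans h2.1) hba
  · intro p q h1 h2
    have h3 := (t.B_iff q p).1 h2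
    rcases t.anc_inv h1 with h1 | h1
    · exact hM.alm _ _ h1 h3.1
    · obtain ⟨rfl, rfl⟩ := hiv p q h1.1 h1.2 (bidir_symm h3.1)
      exact h3.2.1 ⟨rfl, rfl⟩

end TlFacts

/-- Nodes from which the `slide` argument works. -/
inductive Rr (M : PMG V) (a b : V) : V → Prop
  | base : Rr M a b a
  | step (c c' : V) : M.DirEdge c b → M.BidirEdge c c' → Rr M a b c' → Rr M a b c

/-- hypothesis of the single edge lemma -/
def Hv (M : PMG V) (a b : V) : Prop := ∀ c d, Rr M a b c → I M d c → d ≠ b → M.Adj d b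

theorem act_head_congr {G G' : PMG V} {S T T' : Set V} {a : V} {L : List V}
    (hm : ∀ x y, y ≠ a → G.mark x y = G'.mark x y) (hA : ∀ x y, G.Adj x y → G'.Adj x y)
    (ha : a ∉ L) (hT : ∀ y ∈ L, y ∈ T → y ∈ T') (h : Act G S T (a :: L)) :
    Act G' S T' (a :: L) := by
  cases L with
  | nil => trivial
  | cons y l =>
    have hya : y ≠ a := by rintro rfl; simp at ha
    refine ⟨hA _ _ h.1, ?_, act_congr (y :: l) (fun u _ w hw => hm u w ?_) hT h.2.2⟩
    · intro z hz
      have := h.2.1 z hz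
      unfold Ok I at *
      rw [← hm a y hya, ← hm z y hya]
      exact ⟨fun h' => hT y (by simp) (this.1 h'), this.2⟩
    · rintro rfl; exact ha hw

section Single

variable {M M' : PMG V} {a b : V} (t : Tl M M' a b) (hM : AG M) (hM' : AG M') (hv : Hv M a b)

include t hM' hv

theorem single_hii {c : V} (h : M.DirEdge c a) : M.DirEdge c b := by
  have hcb : c ≠ b := by rintro rfl; exact dir_not_bidir' h t.bid
  have h1 := hv a c .base h.1 hcb
  have h2 := hM'.D_trans (ReflTransGen.single (t.D _ _ h)) (ReflTransGen.single t.dir)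
    ((t.adj _ _).2 h1)
  rcases (t.D_iff _ _).1 h2 with h3 | h3
  · exact h3
  · exact absurd h3.1 (adj_ne (dir_adj h))

omit hM' hv in
theorem single_anc {c : V} (h : Rr M a b c) : Anc M' c b := by
  cases h with
  | base => exact ReflTransGen.single t.dir
  | step c c' h1 h2 h3 => exact ReflTransGen.single (t.D _ _ h1)

include hM in
theorem slide {S T : Set V} : ∀ (L : List V) (c x : V), Rr M a b c → Act M S T (c :: x :: L) →
    I M x c → a ∉ x :: L → b ∉ x :: L →
    ∃ x' L', Act M S T (b :: x' :: L') ∧ I M x' b ∧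
      (b :: x' :: L').getLast? = (c :: x :: L).getLast? ∧ ∀ y ∈ x' :: L', y ∈ x :: L := by
  intro L
  induction L with
  | nil =>
    intro c x hc hact hI ha hb
    have hxb : x ≠ b := by rintro rfl; simp at hb
    have h1 := hv c x hc hI hxb
    have h2 : I M' x b := hM'.I_trans ((t.I_iff x c).2 ⟨hI, fun h => hxb h.1⟩) (single_anc t hc)
      ((t.adj _ _).2 h1)
    exact ⟨x, [], ⟨adj_symm h1, by simp, trivial⟩, ((t.I_iff _ _).1 h2).1, by simp, by simp⟩
  | cons x2 L ih =>
    intro c x hc hact hI ha hb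
    have hxb : x ≠ b := by rintro rfl; simp at hb
    have hxa : x ≠ a := by rintro rfl; simp at ha
    have h1 := hv c x hc hI hxb
    have h2 : I M' x b := hM'.I_trans ((t.I_iff x c).2 ⟨hI, fun h => hxb h.1⟩) (single_anc t hc)
      ((t.adj _ _).2 h1)
    have h3 : I M x b := ((t.I_iff _ _).1 h2).1
    have hok := hact.2.1 x2 rfl
    by_cases hok2 : Ok M S T b x x2
    · refine ⟨x, x2 :: L, ⟨adj_symm h1, fun z hz => ?_, hact.2.2⟩, h3, by
        simp [List.getLast?_cons_cons], by simp⟩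
      simp at hz; subst hz; exact hok2
    · by_cases hcol : I M c x ∧ I M x2 x
      · have hxT := hok.1 hcol
        by_cases hbx : I M b x
        · exact absurd ⟨fun _ => hxT, fun h => absurd ⟨hbx, hcol.2⟩ h⟩ hok2
        · have hD := hM.dir_of_not_I h1 hbx
          obtain ⟨x', L', g1, g2, g3, g4⟩ := ih x x2 (.step x c hD ⟨hI, hcol.1⟩ hc) hact.2.2 hcol.2
            (fun h => ha (List.mem_cons_of_mem _ h)) (fun h => hb (List.mem_cons_of_mem _ h))
          refine ⟨x', L', g1, g2, ?_, fun y hy => List.mem_cons_of_mem _ (g4 y hy)⟩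
          rw [g3, List.getLast?_cons_cons (a := c)]
      · have hxS := hok.2 hcol
        by_cases hcol2 : I M b x ∧ I M x2 x
        · exfalso
          have hcx : ¬ I M c x := fun h => hcol ⟨h, hcol2.2⟩
          have hD := hM.dir_of_not_I hI.adj hcx
          have hA : Anc M' x b := ReflTransGen.head (t.D _ _ hD) (single_anc t hc)
          exact hM'.not_anc_of_I ((t.I_iff b x).2 ⟨hcol2.1, fun h => hxa h.2⟩) hA
        · exact absurd ⟨fun h => absurd h hcol2, fun _ => hxS⟩ hok2

omit hM' hv in
theorem single_T {S : Set V} {y : V} (h : y ∈ AnS M S) : y ∈ AnS M' S := by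
  obtain ⟨z, hz, h⟩ := h; exact ⟨z, hz, t.anc h⟩

theorem single_T' {S : Set V} {y : V} (h : y ∈ AnS M' S) (hy : y ≠ a) : y ∈ AnS M S := by
  obtain ⟨z, hz, h⟩ := h
  rcases t.anc_inv h with h | ⟨h1, h2⟩
  · exact ⟨z, hz, h⟩
  · rcases ReflTransGen.cases_tail h1 with h1 | ⟨c, h3, h4⟩
    · exact absurd h1.symm hy
    · exact ⟨z, hz, (ReflTransGen.tail h3 (single_hii t hM' hv h4)).trans h2⟩

omit hM' hv in
theorem single_Ta {S : Set V} (h : a ∈ AnS M' S) (hy : a ∉ AnS M S) : b ∈ AnS M S := by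
  obtain ⟨z, hz, h⟩ := h
  rcases t.anc_inv h with h | ⟨h1, h2⟩
  · exact absurd ⟨z, hz, h⟩ hy
  · exact ⟨z, hz, h2⟩

include hM in
theorem slideA {S T : Set V} {L1 R1 : List V} {z : V} (h1 : Act M S T (a :: b :: L1))
    (h2 : Act M S T (a :: z :: R1)) (hI : I M z a) (ha : a ∉ z :: R1) (hb : b ∉ z :: R1) :
    ∃ R', Act M S T (b :: R') ∧ (b :: R').getLast? = (a :: z :: R1).getLast? ∧ a ∉ R' ∧
      ∀ x y, L1.head? = some x → R'.head? = some y → Ok M S T x b y := by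
  obtain ⟨x', L', g1, g2, g3, g4⟩ := slide t hM hM' hv R1 a z .base h2 hI ha hb
  refine ⟨x' :: L', g1, g3, fun h => ha (g4 _ h), ?_⟩
  rintro x y hx hy
  simp at hy; subst hy
  have := (h1.2.1 x hx)
  have hab : I M a b := t.bid.1
  refine ⟨fun h => this.1 ⟨hab, h.1⟩, fun h => this.2 (fun h' => h ⟨h'.2, g2⟩)⟩

omit hM' hv in
theorem ok_tr {S : Set V} {x y z : V} (hy : y ≠ a) (h : Ok M S (AnS M S) x y z) :
    Ok M' S (AnS M' S) x y z := by
  unfold Ok at *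
  rw [t.I_iff, t.I_iff]
  have : ∀ u, ¬ (u = b ∧ y = a) := fun u h => hy h.2
  simp only [this, not_false_eq_true, and_true]
  exact ⟨fun h' => single_T t (h.1 h'), h.2⟩

omit hM' hv in
theorem act_tr {S : Set V} {l : List V} (ha : a ∉ l) (h : Act M S (AnS M S) l) :
    Act M' S (AnS M' S) l := by
  refine act_congr l (fun u _ w hw => (t.eq u w ?_).symm) (fun y _ => single_T t) h
  rintro ⟨_, rfl⟩; exact ha hw

include hM in
theorem single_core1 {S : Set V} {L1 R1 : List V} {z d e : V}
    (h1 : Act M S (AnS M S) (a :: b :: L1)) (h2 : Act M S (AnS M S) (a :: z :: R1))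
    (hI : I M z a) (ha : a ∉ z :: R1) (hb : b ∉ z :: R1) (ha' : a ∉ b :: L1)
    (hd : (a :: b :: L1).getLast? = some d) (he : (a :: z :: R1).getLast? = some e) :
    Conn M S e d ∧ Conn M' S e d := by
  obtain ⟨R', g1, g2, g3, g4⟩ := slideA t hM hM' hv h1 h2 hI ha hb
  rw [List.getLast?_cons_cons] at hd
  constructor
  · exact conn_glue h1.2.2 hd g1 (g2.trans he) g4
  · refine conn_glue (act_tr t ha' h1.2.2) hd (act_tr t ?_ g1) (g2.trans he)
      (fun x y hx hy => ok_tr t t.ne.symm (g4 x y hx hy))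
    simp [t.ne, g3]

omit hM' hv in
theorem zip_conn {G : PMG V} {S : Set V} {d e : V} (hG : AG G) (h : Conn G S e d) :
    (∃ l, a ∉ d :: l ∧ Act G S (AnS G S) (d :: l) ∧ (d :: l).getLast? = some e) ∨
    ∃ L R, Act G S (AnS G S) (a :: L) ∧ Act G S (AnS G S) (a :: R) ∧
      (a :: L).getLast? = some d ∧ (a :: R).getLast? = some e ∧ a ∉ L ∧ a ∉ R ∧
      (∀ y ∈ L, y ∉ R) ∧
      ∀ x z, L.head? = some x → R.head? = some z → Ok G S (AnS G S) x a z := by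
  obtain ⟨L, h1, h2⟩ := h
  obtain ⟨l, h3, h4, h5, h6⟩ := act_nodup hG _ _ rfl h1
  by_cases ha : a ∈ l
  · right
    obtain ⟨A, R, rfl⟩ := List.append_of_mem ha
    obtain ⟨L', rfl⟩ : ∃ L, A = List.reverse L := ⟨A.reverse, by simp⟩
    obtain ⟨g1, g2, g3⟩ := (act_zip L' a R).1 h4
    refine ⟨L', R, g1, g2, ?_, ?_, ?_, ?_, ?_, g3⟩
    · have : L'.reverse ++ a :: R = (a :: L').reverse ++ R := by simp
      rw [this, List.head?_append_of_ne_nil _ (by simp), List.head?_reverse] at h5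
      simpa using h5
    · rw [List.getLast?_append_of_ne_nil _ (by simp), h2] at h6
      exact h6
    · intro h; simp only [List.nodup_append, List.nodup_cons, List.mem_reverse, List.mem_cons] at h3
      exact h3.2.2 a h a (Or.inl rfl) rfl
    · intro h; simp only [List.nodup_append, List.nodup_cons, List.mem_reverse] at h3
      exact h3.2.1.1 h
    · intro y h h'; simp only [List.nodup_append, List.nodup_cons, List.mem_reverse, List.mem_cons] at h3
      exact h3.2.2 y h y (Or.inr h') rfl
  · left
    obtain ⟨l', rfl⟩ := head_cons (h5.trans rfl)
    exact ⟨l', ha, h4, h6.trans h2⟩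

include hM in
theorem single_dir1 {S : Set V} {d e : V} (h : Conn M S e d) : Conn M' S e d := by
  rcases zip_conn t hM h with ⟨l, ha, h1, h2⟩ | ⟨L, R, h1, h2, h3, h4, h5, h6, h7, h8⟩
  · exact ⟨l, act_tr t ha h1, h2⟩
  · have hm : ∀ x y, y ≠ a → M.mark x y = M'.mark x y := fun x y h => (t.eq x y (fun h' => h h'.2)).symm
    by_cases hok : ∀ x z, L.head? = some x → R.head? = some z → Ok M' S (AnS M' S) x a z
    · exact conn_glue (act_head_congr hm (fun x y => (t.adj x y).2) h5 (fun y _ => single_T t) h1) h3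
        (act_head_congr hm (fun x y => (t.adj x y).2) h6 (fun y _ => single_T t) h2) h4 hok
    · push Not at hok
      obtain ⟨x, z, hx, hz, hno⟩ := hok
      obtain ⟨L, rfl⟩ := head_cons hx
      obtain ⟨R, rfl⟩ := head_cons hz
      have ho := h8 x z rfl rfl
      by_cases hxb : x = b
      · subst hxb
        have hI : I M z a := by
          by_contra hI
          apply hno
          refine ⟨fun h => absurd ((t.I_iff _ _).1 h.2).1 hI, fun _ => ho.2 (fun h => hI h.2)⟩
        exact (single_core1 t hM hM' hv h1 h2 hI h6 (h7 x (by simp)) h5 h3 h4).2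
      by_cases hzb : z = b
      · subst hzb
        have hI : I M x a := by
          by_contra hI
          apply hno
          refine ⟨fun h => absurd ((t.I_iff _ _).1 h.1).1 hI, fun _ => ho.2 (fun h => hI h.1)⟩
        exact conn_symm (single_core1 t hM hM' hv h2 h1 hI h5 (fun h => h7 z h (by simp)) h6 h4 h3).2
      exfalso
      apply hno
      unfold Ok at *
      rw [t.I_iff, t.I_iff]
      simp only [hxb, hzb, false_and, not_false_eq_true, and_true]
      exact ⟨fun h => single_T t (ho.1 h), ho.2⟩

include hM in
theorem single_core2 {S : Set V} {L1 R1 : List V} {x z d e : V}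
    (h1 : Act M S (AnS M S) (a :: x :: L1)) (h2 : Act M S (AnS M S) (a :: z :: R1))
    (hIz : I M z a) (hIx : I M x a)
    (hd : (a :: x :: L1).getLast? = some d) (he : (a :: z :: R1).getLast? = some e)
    (ha : a ∉ x :: L1) (ha' : a ∉ z :: R1) (hb : b ∉ z :: R1) (hbT : b ∈ AnS M S) :
    Conn M S e d := by
  obtain ⟨z', R', g1, g2, g3, g4⟩ := slide t hM hM' hv R1 a z .base h2 hIz ha' hb
  by_cases hbL : b ∈ x :: L1
  · obtain ⟨A, L2, hA⟩ := List.append_of_mem hbL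
    rw [hA] at h1 hd
    obtain ⟨K, hK⟩ : ∃ K, a :: A = List.reverse K := ⟨(a :: A).reverse, by simp⟩
    rw [← List.cons_append, hK] at h1 hd
    obtain ⟨k1, k2, k3⟩ := (act_zip K b L2).1 h1
    obtain ⟨q, hq⟩ : ∃ q, K.head? = some q := by
      cases K with
      | nil => simp at hK
      | cons q K => exact ⟨q, rfl⟩
    rw [List.getLast?_append_of_ne_nil _ (by simp)] at hd
    refine conn_glue k2 hd g1 (g3.trans he) ?_
    intro w y hw hy
    simp at hy; subst hy
    refine ⟨fun _ => hbT, fun h => (k3 q w hq hw).2 (fun h' => h ⟨h'.2, g2⟩)⟩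
  · obtain ⟨x', L', f1, f2, f3, f4⟩ := slide t hM hM' hv L1 a x .base h1 hIx ha hbL
    refine conn_glue f1 (f3.trans hd) g1 (g3.trans he) ?_
    intro w y hw hy
    simp at hw hy; subst hw hy
    exact ⟨fun _ => hbT, fun h => absurd ⟨f2, g2⟩ h⟩

include hM in
theorem single_dir2 {S : Set V} {d e : V} (h : Conn M' S e d) : Conn M S e d := by
  rcases zip_conn t hM' h with ⟨l, ha, h1, h2⟩ | ⟨L, R, h1, h2, h3, h4, h5, h6, h7, h8⟩
  · refine ⟨l, act_congr (d :: l) (fun u _ w hw => (t.eq u w ?_)) (fun y hy h => ?_) h1, h2⟩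
    · rintro ⟨_, rfl⟩; exact ha hw
    · exact single_T' t hM' hv h (by rintro rfl; exact ha hy)
  · have hm : ∀ x y, y ≠ a → M'.mark x y = M.mark x y := fun x y h => (t.eq x y (fun h' => h h'.2))
    have h1' : Act M S (AnS M S) (a :: L) := act_head_congr hm (fun x y => (t.adj x y).1) h5
      (fun y hy h => single_T' t hM' hv h (by rintro rfl; exact h5 hy)) h1
    have h2' : Act M S (AnS M S) (a :: R) := act_head_congr hm (fun x y => (t.adj x y).1) h6
      (fun y hy h => single_T' t hM' hv h (by rintro rfl; exact h6 hy)) h2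
    by_cases hok : ∀ x z, L.head? = some x → R.head? = some z → Ok M S (AnS M S) x a z
    · exact conn_glue h1' h3 h2' h4 hok
    · push Not at hok
      obtain ⟨x, z, hx, hz, hno⟩ := hok
      obtain ⟨L, rfl⟩ := head_cons hx
      obtain ⟨R, rfl⟩ := head_cons hz
      have ho := h8 x z rfl rfl
      have hcol : I M x a ∧ I M z a := by
        by_contra hc
        apply hno
        refine ⟨fun h => absurd h hc, fun _ => ho.2 (fun h => hc ?_)⟩
        exact ⟨((t.I_iff _ _).1 h.1).1, ((t.I_iff _ _).1 h.2).1⟩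
      have haT : a ∉ AnS M S := fun h => hno ⟨fun _ => h, fun h => absurd hcol h⟩
      by_cases hxb : x = b
      · subst hxb
        exact (single_core1 t hM hM' hv h1' h2' hcol.2 h6 (h7 x (by simp)) h5 h3 h4).1
      by_cases hzb : z = b
      · subst hzb
        exact conn_symm (single_core1 t hM hM' hv h2' h1' hcol.1 h5 (fun h => h7 z h (by simp)) h6 h4 h3).1
      have haT' : a ∈ AnS M' S := ho.1 ⟨(t.I_iff _ _).2 ⟨hcol.1, fun h => hxb h.1⟩,
        (t.I_iff _ _).2 ⟨hcol.2, fun h => hzb h.1⟩⟩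
      have hbT := single_Ta t haT' haT
      by_cases hbR : b ∈ z :: R
      · exact conn_symm (single_core2 t hM hM' hv h2' h1' hcol.1 hcol.2 h4 h3 h6 h5
          (fun h => h7 b h hbR) hbT)
      · exact single_core2 t hM hM' hv h1' h2' hcol.2 hcol.1 h3 h4 h5 h6 hbR hbT

include hM in
theorem single_eqv : Eqv M M' := fun _ _ _ _ _ _ =>
  ⟨single_dir1 t hM hM' hv, single_dir2 t hM hM' hv⟩

end Single

end PMGAux

namespace PMGAux

open PMG Relation

variable {V : Type}

/-! ### The discriminating path lemma -/

theorem dp_lemma {M M2 : PMG V} (hM : IsMAG M) (he : Eqv M M2)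
    {a b v Y : V} (hav : Anc M a v) (hvY : M2.DirEdge v Y) (hYb : Anc M Y b)
    (hab : M.BidirEdge a b) : Hv M a b := by
  intro c d hR hI hdb
  by_contra hn
  obtain ⟨S, hdS, hbS, hs⟩ := (mag_iff.1 hM).2 d b hdb hn
  have hs' : ¬ Conn M (S : Set V) b d := fun h => hs (conn_symm h)
  have claim : ∀ c, Rr M a b c → ConnI M (S : Set V) d c → ConnI M (S : Set V) d a := by
    intro c hc
    induction hc with
    | base => exact id
    | step c c' h1 h2 h3 ih =>
      intro h
      by_cases hcS : c ∈ (S : Set V)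
      · exact ih (connI_coll h (sub_AnS hcS) h2)
      · exact absurd (conn_step_out h.conn hcS h1).conn hs
  have hda := claim c hR (connI_I hI)
  have haA : a ∉ AnS M (S : Set V) := fun h => hs (connI_coll hda h hab).conn
  have hdv := conn_down hda.conn haA hav
  have hbv := conn_down (conn_adj (S := (S : Set V)) (bidir_adj (bidir_symm hab))) haA hav
  have hvA : v ∉ AnS M (S : Set V) := fun h => haA (AnS_up hav h)
  have hvS : v ∉ (S : Set V) := fun h => hvA (sub_AnS h)
  have hvd : v ≠ d := by rintro rfl; exact hs' hbv
  have hvb : v ≠ b := by rintro rfl; exact hs hdv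
  have hdv2 := (he S d v hvd.symm hdS (by simpa using hvS)).1 hdv
  have hbv2 := (he S b v hvb.symm hbS (by simpa using hvS)).1 hbv
  have hs2 : ¬ Conn M2 (S : Set V) d b := fun h => hs ((he S d b hdb hdS hbS).2 h)
  have hs2' : ¬ Conn M2 (S : Set V) b d := fun h => hs2 (conn_symm h)
  have hvA2 : v ∉ AnS M2 (S : Set V) := fun h => hs2' (conn_join hdv2 hbv2 hvS h)
  have hdY := (conn_step_out hdv2 hvS hvY).conn
  have hbY := (conn_step_out hbv2 hvS hvY).conn
  have hYS : Y ∉ (S : Set V) := fun h => hvA2 (AnS_up (.single hvY) (sub_AnS h))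
  have hYd : Y ≠ d := by rintro rfl; exact hs2' hbY
  have hYb' : Y ≠ b := by rintro rfl; exact hs2 hdY
  have h1 := (he S d Y hYd.symm hdS (by simpa using hYS)).2 hdY
  have h2 := (he S b Y hYb'.symm hbS (by simpa using hYS)).2 hbY
  by_cases hYA : Y ∈ AnS M (S : Set V)
  · exact hs' (conn_join h1 h2 hYS hYA)
  · exact hs (conn_down h1 hYA hYb)

/-! ### Equivalence classes -/

/-- Markov equivalence class, in terms of connection. -/
structure Cls (cls : Set (PMG V)) : Prop where
  mag : ∀ M ∈ cls, IsMAG M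
  closed : ∀ M ∈ cls, ∀ M', AG M' → Eqv M M' → (∀ a b, M.Adj a b ↔ M'.Adj a b) → M' ∈ cls
  eqv : ∀ M ∈ cls, ∀ M' ∈ cls, Eqv M M'
  adj : ∀ M ∈ cls, ∀ M' ∈ cls, ∀ a b, M.Adj a b ↔ M'.Adj a b

theorem Cls.ag {cls : Set (PMG V)} (hc : Cls cls) {M : PMG V} (h : M ∈ cls) : AG M :=
  (mag_iff.1 (hc.mag M h)).1

theorem cls_of_pag {P : PMG V} {cls : Set (PMG V)} (hP : IsPAGOf P cls) : Cls cls := by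
  obtain ⟨_, h1, h2, h3, h4, _, _⟩ := hP
  refine ⟨h1, ?_, ?_, ?_⟩
  · intro M hM M' hM' he ha
    have hg := (mag_iff.1 (h1 M hM)).1
    exact h2 M hM M' (mag_transfer (h1 M hM) hM' he ha) ((eqv_iff hg hM').2 he)
  · intro M hM M' hM'
    exact (eqv_iff (mag_iff.1 (h1 M hM)).1 (mag_iff.1 (h1 M' hM')).1).1 (h3 M hM M' hM')
  · intro M hM M' hM' a b
    rw [← h4 M hM, h4 M' hM']

variable [Fintype V]

/-- number of bidirected pairs -/
noncomputable def nb (M : PMG V) : ℕ := {p : V × V | M.BidirEdge p.1 p.2}.ncard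

theorem nb_lt {M M' : PMG V} (h : ∀ x y, M'.BidirEdge x y → M.BidirEdge x y) {a b : V}
    (h1 : M.BidirEdge a b) (h2 : ¬ M'.BidirEdge a b) : nb M' < nb M := by
  apply Set.ncard_lt_ncard _ (Set.toFinite _)
  refine ⟨fun p hp => h _ _ hp, fun hs => h2 (hs (a := (a, b)) h1)⟩

theorem An_card_lt {M : PMG V} (hM : AG M) {x y : V} (h : Anc M x y) (hne : x ≠ y) :
    {w | Anc M w x}.ncard < {w | Anc M w y}.ncard := by
  apply Set.ncard_lt_ncard _ (Set.toFinite _)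
  refine ⟨fun w hw => ReflTransGen.trans hw h, fun hs => hne ?_⟩
  have : Anc M y x := hs (a := y) (ReflTransGen.refl)
  exact hM.acyc _ _ h this

theorem De_card_lt {M : PMG V} (hM : AG M) {x y : V} (h : Anc M x y) (hne : x ≠ y) :
    {w | Anc M y w}.ncard < {w | Anc M x w}.ncard := by
  apply Set.ncard_lt_ncard _ (Set.toFinite _)
  refine ⟨fun w hw => ReflTransGen.trans h hw, fun hs => hne ?_⟩
  have : Anc M y x := hs (a := x) (ReflTransGen.refl)
  exact hM.acyc _ _ h this

theorem leg_step {cls : Set (PMG V)} (hc : Cls cls) {M2 : PMG V} (hM2 : M2 ∈ cls) {c u v : V}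
    (hvu : M2.DirEdge v u) : ∀ (n : ℕ) (M : PMG V), nb M = n → M ∈ cls → M.BidirEdge c u →
    Anc M c v → ∃ M' ∈ cls, (∀ x y, M.DirEdge x y → M'.DirEdge x y) ∧ M'.DirEdge c u ∧
      ∀ x y, M'.BidirEdge x y → M.BidirEdge x y := by
  intro n
  induction n using Nat.strong_induction_on with
  | _ n ih =>
    intro M hn hM hB hcv
    have hg := hc.ag hM
    obtain ⟨⟨a, b⟩, ⟨hav, hub, hab⟩, hmin⟩ := Set.exists_min_image
      {p : V × V | Anc M p.1 v ∧ Anc M u p.2 ∧ M.BidirEdge p.1 p.2}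
      (fun p => {w | Anc M w p.1}.ncard + {w | Anc M p.2 w}.ncard) (Set.toFinite _)
      ⟨(c, u), hcv, .refl, hB⟩
    simp only at hav hub hab
    obtain ⟨M', t⟩ := exists_Tl hab
    have hg' : AG M' := by
      refine t.ag hg (fun x y hx hy hxy => ?_)
      have h1 := hmin (x, y) ⟨hx.trans hav, hub.trans hy, hxy⟩
      simp only at h1
      by_cases hxa : x = a
      · refine ⟨hxa, ?_⟩
        by_contra hyb
        subst hxa
        have := De_card_lt hg hy (Ne.symm hyb)
        omega
      · exfalso
        have h2 := An_card_lt hg hx hxa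
        by_cases hyb : y = b
        · subst hyb; omega
        · have := De_card_lt hg hy (Ne.symm hyb)
          omega
    have hv := dp_lemma (hc.mag M hM) (hc.eqv M hM M2 hM2) hav hvu hub hab
    have hM' : M' ∈ cls := hc.closed M hM M' hg' (single_eqv t hg hg' hv)
      (fun x y => (t.adj x y).symm)
    have hBsub : ∀ x y, M'.BidirEdge x y → M.BidirEdge x y := fun x y h => ((t.B_iff x y).1 h).1
    by_cases hcu : c = a ∧ u = b
    · obtain ⟨rfl, rfl⟩ := hcu
      exact ⟨M', hM', t.D, t.dir, hBsub⟩
    · have hlt : nb M' < nb M := nb_lt hBsub hab (fun h => ((t.B_iff a b).1 h).2.2 ⟨rfl, rfl⟩)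
      have hB' : M'.BidirEdge c u := by
        refine (t.B_iff c u).2 ⟨hB, ?_, hcu⟩
        rintro ⟨rfl, rfl⟩
        exact hg.alm _ _ hub (bidir_symm hab)
      obtain ⟨M3, g1, g2, g3, g4⟩ := ih _ (hn ▸ hlt) M' rfl hM' hB' (t.anc hcv)
      exact ⟨M3, g1, fun x y h => g2 x y (t.D x y h), g3, fun x y h => hBsub x y (g4 x y h)⟩

/-- Members of the class all of whose bidirected edges are invariant. -/
def IsLeg (cls : Set (PMG V)) (L : PMG V) : Prop :=
  L ∈ cls ∧ ∀ c u, L.BidirEdge c u → ∀ M ∈ cls, M.BidirEdge c u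

theorem p1b {cls : Set (PMG V)} (hc : Cls cls) {c u v : V} (hB : ∀ M ∈ cls, M.BidirEdge c u)
    {M M2 : PMG V} (hM : M ∈ cls) (hM2 : M2 ∈ cls) (h1 : M.DirEdge c v) (h2 : M2.DirEdge v u) :
    False := by
  obtain ⟨M', g1, _, g2, _⟩ := leg_step hc hM2 h2 _ M rfl hM (hB M hM) (ReflTransGen.single h1)
  exact dir_not_bidir g2 (hB M' g1)

theorem exists_leg {cls : Set (PMG V)} (hc : Cls cls) : ∀ (n : ℕ) (M : PMG V), nb M = n → M ∈ cls →
    ∃ L, IsLeg cls L ∧ ∀ x y, M.DirEdge x y → L.DirEdge x y := by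
  intro n
  induction n using Nat.strong_induction_on with
  | _ n ih =>
    intro M hn hM
    by_cases hL : ∀ c u, M.BidirEdge c u → ∀ M2 ∈ cls, M2.BidirEdge c u
    · exact ⟨M, ⟨hM, hL⟩, fun _ _ h => h⟩
    · push Not at hL
      obtain ⟨c, u, hB, M2, hM2, hn2⟩ := hL
      have key : ∀ c u, M.BidirEdge c u → M2.DirEdge c u →
          ∃ L, IsLeg cls L ∧ ∀ x y, M.DirEdge x y → L.DirEdge x y := by
        intro c u hB hD
        obtain ⟨M', g1, g2, g3, g4⟩ := leg_step hc hM2 hD _ M rfl hM hB .refl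
        obtain ⟨L, f1, f2⟩ := ih _ (hn ▸ nb_lt g4 hB (dir_not_bidir g3)) M' rfl g1
        exact ⟨L, f1, fun x y h => f2 x y (g2 x y h)⟩
      rcases (hc.ag hM2).mixed c u ((hc.adj M hM M2 hM2 c u).1 (bidir_adj hB)) with h | h | h
      · exact key c u hB h
      · exact key u c (bidir_symm hB) h
      · exact absurd h hn2

end PMGAux

namespace PMGAux

open PMG Relation

variable {V : Type}

/-! ### Covered edge reversal -/

/-- The edge `u → v` is covered in `M`. -/
structure Covered (M : PMG V) (u v : V) : Prop where
  dir : M.DirEdge u v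
  c1 : ∀ c, M.DirEdge c u → M.DirEdge c v
  c2 : ∀ c, M.BidirEdge c u → M.BidirEdge c v
  c3 : ∀ c, M.DirEdge c v → c ≠ u → M.DirEdge c u
  c4 : ∀ c, M.BidirEdge c v → M.BidirEdge c u

theorem eqv_trans {A B C : PMG V} (h1 : Eqv A B) (h2 : Eqv B C) : Eqv A C :=
  fun S a b hab ha hb => (h1 S a b hab ha hb).trans (h2 S a b hab ha hb)

theorem eqv_symm {A B : PMG V} (h1 : Eqv A B) : Eqv B A :=
  fun S a b hab ha hb => (h1 S a b hab ha hb).symm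

theorem covered_rev {cls : Set (PMG V)} (hc : Cls cls) {M : PMG V} (hM : M ∈ cls) {u v : V}
    (cov : Covered M u v) : ∃ M3 ∈ cls,
      (∀ x y, M3.DirEdge x y ↔ (M.DirEdge x y ∧ ¬ (x = u ∧ y = v)) ∨ (x = v ∧ y = u)) ∧
      (∀ x y, M3.BidirEdge x y ↔ M.BidirEdge x y) := by
  have hg := hc.ag hM
  obtain ⟨M2, t⟩ := exists_Tl' cov.dir
  obtain ⟨M3, t3⟩ := exists_Tl (bidir_symm t.bid)
  have hne := t.ne
  have D2 : ∀ x y, M2.DirEdge x y → M.DirEdge x y := t.D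
  have A2 : ∀ x y, Anc M2 x y → Anc M x y := fun x y h => t.anc h
  have nD2 : ¬ M2.DirEdge u v := fun h => dir_not_bidir h t.bid
  have B2 : ∀ x y, M2.BidirEdge x y → M.BidirEdge x y ∨ (x = v ∧ y = u) ∨ (x = u ∧ y = v) := by
    intro x y h
    have := t.B_iff x y
    tauto
  -- the last edge of a directed path into v in M2
  have hin : ∀ x, Anc M2 x v → x ≠ v → ∃ c, Anc M x c ∧ M.DirEdge c u := by
    intro x hx hxv
    rcases ReflTransGen.cases_tail hx with h | ⟨c, h1, h2⟩
    · exact absurd h.symm hxv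
    · refine ⟨c, A2 _ _ h1, cov.c3 c (D2 _ _ h2) ?_⟩
      rintro rfl; exact nD2 h2
  have ncyc : ∀ c, Anc M u c → ¬ M.DirEdge c u := by
    intro c h1 h2
    exact adj_ne (dir_adj h2) (hg.acyc _ _ (.single h2) h1)
  have hg2 : AG M2 := by
    refine ⟨?_, fun a b h1 h2 => hg.acyc _ _ (A2 _ _ h1) (A2 _ _ h2), ?_⟩
    · intro x y h
      have h1 := t.B_iff x y
      have h2 := t.D_iff x y
      have h3 := t.D_iff y x
      have h4 := t.bid
      have h5 := bidir_symm t.bid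
      by_cases e1 : x = u ∧ y = v
      · obtain ⟨rfl, rfl⟩ := e1; exact Or.inr (Or.inr h4)
      by_cases e2 : x = v ∧ y = u
      · obtain ⟨rfl, rfl⟩ := e2; exact Or.inr (Or.inr h5)
      rcases hg.mixed x y ((t.adj x y).2 h) with h | h | h <;> tauto
    · intro p q h1 h2
      rcases B2 q p h2 with h | ⟨rfl, rfl⟩ | ⟨rfl, rfl⟩
      · exact hg.alm _ _ (A2 _ _ h1) h
      · obtain ⟨c, g1, g2⟩ := hin p h1 hne
        exact ncyc c g1 g2
      · exact hne (hg.acyc _ _ (.single cov.dir) (A2 _ _ h1))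
  have hv1 : Hv M2 u v := by
    have hR : ∀ c, Rr M2 u v c → c = u := by
      intro c h
      induction h with
      | base => rfl
      | step c c' h1 h2 h3 ih =>
        subst ih
        exfalso
        have hcu := adj_ne (bidir_adj h2)
        have h4 := cov.c3 c (D2 _ _ h1) hcu
        rcases B2 _ _ h2 with h | ⟨rfl, _⟩ | ⟨rfl, _⟩
        · exact dir_not_bidir h4 h
        · exact adj_ne (dir_adj h1) rfl
        · exact hcu rfl
    intro c d hc hI hd
    have := hR c hc
    subst this
    have hI' : I M d c := (t.I_iff d c).2 ⟨hI, fun h => hd h.1⟩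
    rw [← t.adj]
    rcases hg.I_or hI' with h | h
    · exact dir_adj (cov.c1 _ h)
    · exact bidir_adj (cov.c2 _ h)
  have hv2 : Hv M2 v u := by
    have hR : ∀ c, Rr M2 v u c → c = v := by
      intro c h
      induction h with
      | base => rfl
      | step c c' h1 h2 h3 ih =>
        subst ih
        exfalso
        have hcv := adj_ne (bidir_adj h2)
        have h4 := cov.c1 c (D2 _ _ h1)
        rcases B2 _ _ h2 with h | ⟨rfl, _⟩ | ⟨rfl, _⟩
        · exact dir_not_bidir h4 h
        · exact hcv rfl
        · exact adj_ne (dir_adj h1) rfl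
    intro c d hc hI hd
    have := hR c hc
    subst this
    have hI' : I M d c := (t.I_iff d c).2 ⟨hI, fun h => hne h.2.symm⟩
    rw [← t.adj]
    rcases hg.I_or hI' with h | h
    · exact dir_adj (cov.c3 _ h hd)
    · exact bidir_adj (cov.c4 _ h)
  have hg3 : AG M3 := by
    refine t3.ag hg2 (fun x y hx hy hxy => ?_)
    by_cases hxv : x = v
    · refine ⟨hxv, ?_⟩
      subst hxv
      rcases B2 _ _ hxy with h | ⟨_, h⟩ | ⟨h, _⟩
      · exact absurd (cov.c4 _ (bidir_symm h)) (hg.alm _ _ (A2 _ _ hy))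
      · exact h
      · exact absurd h.symm hne
    · exfalso
      obtain ⟨c, g1, g2⟩ := hin x hx hxv
      rcases B2 _ _ hxy with h | ⟨h, _⟩ | ⟨rfl, _⟩
      · exact hg.alm x y ((ReflTransGen.tail g1 g2).trans (A2 _ _ hy)) (bidir_symm h)
      · exact hxv h
      · exact ncyc c g1 g2
  have e : Eqv M M3 := eqv_trans (eqv_symm (single_eqv t hg2 hg hv1)) (single_eqv t3 hg2 hg3 hv2)
  refine ⟨M3, hc.closed M hM M3 hg3 e (fun a b => (t.adj a b).trans (t3.adj a b).symm), ?_, ?_⟩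
  · intro x y
    have h1 := t3.D_iff x y
    have h2 := t.D_iff x y
    have : M2.DirEdge x y → ¬ (x = u ∧ y = v) := by
      rintro h ⟨rfl, rfl⟩; exact nD2 h
    tauto
  · intro x y
    have h1 := t3.B_iff x y
    have h2 := t.B_iff x y
    tauto

variable [Fintype V]

/-- Edges directed oppositely. -/
def Rev (M M2 : PMG V) : Set (V × V) := {p | M.DirEdge p.1 p.2 ∧ M2.DirEdge p.2 p.1}

theorem exists_covered {cls : Set (PMG V)} (hc : Cls cls) {M M2 : PMG V} (hM : IsLeg cls M)
    (hM2 : IsLeg cls M2) (hne : (Rev M M2).Nonempty) :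
    ∃ u v, Covered M u v ∧ M2.DirEdge v u := by
  have hg := hc.ag hM.1
  have hg2 := hc.ag hM2.1
  have hadj := hc.adj M hM.1 M2 hM2.1
  have hadj2 := hc.adj M2 hM2.1 M hM.1
  have he := hc.eqv M hM.1 M2 hM2.1
  have he2 := hc.eqv M2 hM2.1 M hM.1
  have mg := hc.mag M hM.1
  have mg2 := hc.mag M2 hM2.1
  obtain ⟨⟨u0, v⟩, hr0, hmin⟩ := Set.exists_min_image (Rev M M2)
    (fun p => {w | Anc M w p.2}.ncard) (Set.toFinite _) hne
  obtain ⟨u, ⟨hu1, hu2⟩, hmax⟩ := Set.exists_max_image {u | M.DirEdge u v ∧ M2.DirEdge v u}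
    (fun u => {w | Anc M w u}.ncard) (Set.toFinite _) ⟨u0, hr0⟩
  have noV : ∀ p q, M.DirEdge p q → M2.DirEdge q p → Anc M q v → q ≠ v → False := by
    intro p q h1 h2 h3 h4
    have a1 := hmin (p, q) ⟨h1, h2⟩
    have a2 := An_card_lt hg h3 h4
    simp only at a1
    omega
  have huv := adj_ne (dir_adj hu1)
  have e2 : ∀ c, M.BidirEdge c u → M.BidirEdge c v := by
    intro c h
    have hcv : c ≠ v := by rintro rfl; exact dir_not_bidir' hu1 h
    by_cases ha : M.Adj c v
    · rcases hg.mixed c v ha with h1 | h1 | h1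
      · exact (p1b hc (hM.2 c u h) hM.1 hM2.1 h1 hu2).elim
      · exact absurd h (hg.alm u c (ReflTransGen.head hu1 (.single h1)))
      · exact h1
    · exfalso
      have := unshielded mg2 mg he2 hadj2 hcv (fun h => ha ((hadj _ _).2 h)) (hM.2 c u h M2 hM2.1).1 hu2.1
      exact dir_not_I hu1 this.2
  refine ⟨u, v, ⟨hu1, ?_, e2, ?_, ?_⟩, hu2⟩
  · intro c h
    have hcv : c ≠ v := by rintro rfl; exact dir_asymm hu1 h
    by_cases ha : M.Adj c v
    · exact hg.D_trans (.single h) (.single hu1) ha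
    · exfalso
      by_cases hI : I M2 c u
      · have := unshielded mg2 mg he2 hadj2 hcv (fun h => ha ((hadj _ _).2 h)) hI hu2.1
        exact dir_not_I hu1 this.2
      · have h2 := hg2.dir_of_not_I (adj_symm ((hadj _ _).1 (dir_adj h))) hI
        exact noV c u h h2 (.single hu1) huv
  · intro c h hcu
    by_cases ha : M.Adj c u
    · rcases hg.mixed c u ha with h1 | h1 | h1
      · exact h1
      · exfalso
        rcases hg2.mixed c v ((hadj _ _).1 (dir_adj h)) with h2 | h2 | h2
        · have h3 := hg2.D_trans (.single h2) (.single hu2) ((hadj _ _).1 ha)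
          exact noV u c h1 h3 (.single h) (adj_ne (dir_adj h))
        · have a1 := hmax c ⟨h, h2⟩
          have a2 := An_card_lt hg (ReflTransGen.single h1) (Ne.symm hcu)
          omega
        · exact dir_not_bidir h (hM2.2 c v h2 M hM.1)
      · exact absurd (e2 c h1) (dir_not_bidir h)
    · exfalso
      have := unshielded mg mg2 he hadj hcu ha h.1 hu1.1
      exact dir_not_I hu2 this.2
  · intro c h
    have hcu : c ≠ u := by rintro rfl; exact dir_not_bidir hu1 h
    by_cases ha : M.Adj c u
    · rcases hg.mixed c u ha with h1 | h1 | h1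
      · exact absurd (bidir_symm h) (hg.alm c v (ReflTransGen.head h1 (.single hu1)))
      · exact (p1b hc (hM.2 v c (bidir_symm h)) hM2.1 hM.1 hu2 h1).elim
      · exact h1
    · exfalso
      have := unshielded mg mg2 he hadj hcu ha h.1 hu1.1
      exact dir_not_I hu2 this.2

end PMGAux

namespace PMGAux

open PMG Relation

variable {V : Type}

/-! ### The invariant -/

/-- directed edge into a node satisfying `Q` -/
def DQ (M : PMG V) (Q : V → Prop) (u w : V) : Prop := M.DirEdge u w ∧ Q w

theorem anc_iff_DQ {M : PMG V} {a b : V} :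
    Anc M a b ↔ ReflTransGen (DQ M (fun _ => True)) a b := by
  have : DQ M (fun _ => True) = M.DirEdge := by
    funext u w; simp [DQ]
  rw [this]; rfl

/-- a proper causal path from `X` to `R` whose first node outside `X` is an ancestor of `S` -/
def Phi (M : PMG V) (X : Finset V) (R S : V) : Prop :=
  ∃ x ∈ X, ∃ N, N ∉ X ∧ M.DirEdge x N ∧ ReflTransGen (DQ M (fun w => w ∉ X)) N R ∧ Anc M N S

/-- first edges of proper causal paths to `R` are invariant -/
def Amen (cls : Set (PMG V)) (X : Finset V) (R : V) : Prop :=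
  ∀ M ∈ cls, ∀ x ∈ X, ∀ N, N ∉ X → M.DirEdge x N →
    ReflTransGen (DQ M (fun w => w ∉ X)) N R → ∀ M2 ∈ cls, M2.DirEdge x N

theorem rev_path {M M3 : PMG V} {u v : V} (cov : Covered M u v)
    (hD : ∀ x y, M3.DirEdge x y ↔ (M.DirEdge x y ∧ ¬ (x = u ∧ y = v)) ∨ (x = v ∧ y = u))
    {Q : V → Prop} {N R : V} (h : ReflTransGen (DQ M Q) N R) :
    ReflTransGen (DQ M3 Q) N R ∨ (N = u ∧ Q v ∧ ReflTransGen (DQ M3 Q) v R) := by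
  have huv := adj_ne (dir_adj cov.dir)
  induction h using ReflTransGen.head_induction_on with
  | refl => exact Or.inl .refl
  | head h1 h2 ih =>
    rename_i N N1
    by_cases he : N = u ∧ N1 = v
    · obtain ⟨rfl, rfl⟩ := he
      rcases ih with ih | ih
      · exact Or.inr ⟨rfl, h1.2, ih⟩
      · exact absurd ih.1.symm huv
    · have h3 : M3.DirEdge N N1 := (hD _ _).2 (Or.inl ⟨h1.1, he⟩)
      left
      rcases ih with ih | ⟨rfl, hv, ih⟩
      · exact ih.head ⟨h3, h1.2⟩
      · refine ih.head ⟨(hD _ _).2 (Or.inl ⟨cov.c1 _ h1.1, fun h => ?_⟩), hv⟩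
        exact adj_ne (dir_adj h1.1) h.1

theorem phi_rev {cls : Set (PMG V)} {M M3 : PMG V} (hM : M ∈ cls) (hM3 : M3 ∈ cls) {u v : V}
    (cov : Covered M u v)
    (hD : ∀ x y, M3.DirEdge x y ↔ (M.DirEdge x y ∧ ¬ (x = u ∧ y = v)) ∨ (x = v ∧ y = u))
    {X : Finset V} {R S : V} (hA : Amen cls X R) (h : Phi M X R S) : Phi M3 X R S := by
  obtain ⟨x, hx, N, hN, hxN, hR, hS⟩ := h
  have h3 := hA M hM x hx N hN hxN hR M3 hM3
  rw [anc_iff_DQ] at hS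
  have vu : M3.DirEdge v u := (hD v u).2 (Or.inr ⟨rfl, rfl⟩)
  have move : N = u → v ∉ X → ReflTransGen (DQ M3 (fun w => w ∉ X)) v R →
      ReflTransGen (DQ M3 (fun _ => True)) v S → Phi M3 X R S := by
    rintro rfl hv h1 h2
    refine ⟨x, hx, v, hv, (hD _ _).2 (Or.inl ⟨cov.c1 _ hxN, fun h => ?_⟩), h1, anc_iff_DQ.2 h2⟩
    exact adj_ne (dir_adj hxN) h.1
  rcases rev_path cov hD hR with hR' | ⟨e, hv, hR'⟩
  · rcases rev_path cov hD hS with hS' | ⟨e, _, hS'⟩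
    · exact ⟨x, hx, N, hN, h3, hR', anc_iff_DQ.2 hS'⟩
    · refine move e ?_ (hR'.head ⟨e ▸ vu, hN⟩) hS'
      intro hv
      subst e
      exact dir_asymm cov.dir (hA M3 hM3 v hv N hN vu hR' M hM)
  · rcases rev_path cov hD hS with hS' | ⟨_, _, hS'⟩
    · exact move e hv hR' (hS'.head ⟨e ▸ vu, trivial⟩)
    · exact move e hv hR' hS'

variable [Fintype V]

theorem phi_inv {cls : Set (PMG V)} (hc : Cls cls) {M2 : PMG V} (hM2 : IsLeg cls M2)
    {X : Finset V} {R S : V} (hA : Amen cls X R) : ∀ (n : ℕ) (M : PMG V), (Rev M M2).ncard = n →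
    IsLeg cls M → Phi M X R S → Phi M2 X R S := by
  intro n
  induction n using Nat.strong_induction_on with
  | _ n ih =>
    intro M hn hM h
    by_cases hne : (Rev M M2).Nonempty
    · obtain ⟨u, v, cov, hvu⟩ := exists_covered hc hM hM2 hne
      obtain ⟨M3, hM3, hD, hB⟩ := covered_rev hc hM.1 cov
      refine ih _ ?_ M3 rfl ⟨hM3, fun c w h => hM.2 c w ((hB c w).1 h)⟩ (phi_rev hM.1 hM3 cov hD hA h)
      rw [← hn]
      apply Set.ncard_lt_ncard _ (Set.toFinite _)
      refine ⟨?_, fun hs => ?_⟩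
      · rintro ⟨x, y⟩ ⟨h1, h2⟩
        simp only at h1 h2
        rcases (hD _ _).1 h1 with h3 | ⟨rfl, rfl⟩
        · exact ⟨h3.1, h2⟩
        · exact absurd hvu (dir_asymm h2)
      · have h4 : (u, v) ∈ Rev M M2 := ⟨cov.dir, hvu⟩
        have h5 := (hs h4).1
        rcases (hD _ _).1 h5 with h6 | h6
        · exact h6.2 ⟨rfl, rfl⟩
        · exact adj_ne (dir_adj cov.dir) h6.1
    · have hsub : ∀ x y, M.DirEdge x y → M2.DirEdge x y := by
        intro x y hxy
        rcases (hc.ag hM2.1).mixed x y ((hc.adj M hM.1 M2 hM2.1 x y).1 (dir_adj hxy)) with g | g | g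
        · exact g
        · exact absurd ⟨(x, y), hxy, g⟩ hne
        · exact absurd (hM2.2 x y g M hM.1) (dir_not_bidir hxy)
      obtain ⟨x, hx, N, hN, h1, h2, h3⟩ := h
      exact ⟨x, hx, N, hN, hsub _ _ h1,
        ReflTransGen.mono (fun a b h => ⟨hsub _ _ h.1, h.2⟩) _ _ h2,
        ReflTransGen.mono (fun a b h => hsub _ _ h) _ _ h3⟩

/-! ### Possibly directed edges of the PAG -/

/-- possibly directed edge -/
def PD (P : PMG V) (u w : V) : Prop := P.Adj u w ∧ P.mark w u ≠ some Mark.arrow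

/-- possibly directed edge into a node outside `X` -/
def PDX (P : PMG V) (X : Finset V) (u w : V) : Prop := PD P u w ∧ w ∉ X

omit [Fintype V] in
theorem pd_of_dir {P : PMG V} {cls : Set (PMG V)} (hP : IsPAGOf P cls) {M : PMG V} (hM : M ∈ cls)
    {u w : V} (h : M.DirEdge u w) : PD P u w := by
  obtain ⟨_, _, _, _, h4, h5, _⟩ := hP
  refine ⟨(h4 M hM u w).2 (dir_adj h), fun hm => ?_⟩
  exact dir_not_I h (((h5 w u).1 hm).2 M hM)

omit [Fintype V] in
theorem exists_dir {P : PMG V} {cls : Set (PMG V)} (hP : IsPAGOf P cls) {u w : V} (h : PD P u w) :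
    ∃ M ∈ cls, M.DirEdge u w := by
  have hc := cls_of_pag hP
  obtain ⟨_, _, _, _, h4, h5, _⟩ := hP
  have : ¬ (∀ M ∈ cls, M.mark w u = some Mark.arrow) :=
    fun h' => h.2 ((h5 w u).2 ⟨adj_symm h.1, h'⟩)
  push Not at this
  obtain ⟨M, hM, hm⟩ := this
  exact ⟨M, hM, (hc.ag hM).dir_of_not_I ((h4 M hM u w).1 h.1) hm⟩

omit [Fintype V] in
theorem dir_of_pdir {P : PMG V} {cls : Set (PMG V)} (hP : IsPAGOf P cls) {u w : V}
    (h : P.DirEdge u w) {M : PMG V} (hM : M ∈ cls) : M.DirEdge u w := by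
  obtain ⟨_, _, _, _, _, h5, h6⟩ := hP
  exact ⟨((h5 u w).1 h.1).2 M hM, ((h6 w u).1 h.2).2 M hM⟩

omit [Fintype V] in
theorem possDir_chain {P : PMG V} {p : List V} (h : p.IsChain (PD P)) :
    p.IsChain P.Adj ∧ PossDirAlong P p := by
  refine ⟨h.imp (fun _ _ h => h.1), ?_⟩
  intro i a b ha hb
  exact ((chain_iff p).1 h i a b ha hb).2

omit [Fintype V] in
theorem chain_possDir {P : PMG V} {p : List V} (h1 : p.IsChain P.Adj) (h2 : PossDirAlong P p) :
    p.IsChain (PD P) :=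
  (chain_iff p).2 (fun i a b ha hb => ⟨(chain_iff p).1 h1 i a b ha hb, h2 i a b ha hb⟩)

omit [Fintype V] in
/-- extend a chain avoiding `X` to a proper path -/
theorem proper_of_chain {G : PMG V} {r : V → V → Prop} {X Y : Finset V} {x N y : V}
    (hr : ∀ a b, r a b → G.Adj a b) (hx : x ∈ X) (hN : N ∉ X) (hy : y ∈ Y) (hxN : r x N)
    (h : ReflTransGen (fun a b => r a b ∧ b ∉ X) N y) :
    ∃ l, ProperPath G X Y (x :: N :: l) ∧ (x :: N :: l).IsChain r := by
  obtain ⟨l, h1, h2, h3⟩ := rtg_list h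
  have hX : ∀ c ∈ N :: l, c ∉ X := by
    intro c hc
    rcases List.mem_cons.1 hc with rfl | hc
    · exact hN
    · obtain ⟨i, hi⟩ := List.mem_iff_getElem?.1 hc
      have hlt : i < (N :: l).length := by
        have := (List.getElem?_eq_some_iff.1 hi).1
        simp; omega
      exact ((chain_iff _).1 h2 i (N :: l)[i] c (by simp) (by simpa using hi)).2
  have hch : (x :: N :: l).IsChain r :=
    List.isChain_cons_cons.2 ⟨hxN, h2.imp (fun _ _ h => h.1)⟩
  refine ⟨l, ⟨⟨by simp, ?_, hch.imp hr⟩, ⟨x, hx, rfl⟩, ⟨y, hy, ?_⟩, hX⟩, hch⟩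
  · exact List.nodup_cons.2 ⟨fun h => hX x h hx, h1⟩
  · rw [List.getLast?_cons_cons]; exact h3

omit [Fintype V] in
theorem amen_edge {P : PMG V} {X Y : Finset V} (hAm : Amenable P (Visible P) X Y) {x N y : V}
    (hx : x ∈ X) (hN : N ∉ X) (hy : y ∈ Y) (hxN : PD P x N) (h : ReflTransGen (PDX P X) N y) :
    P.DirEdge x N := by
  obtain ⟨l, h1, h2⟩ := proper_of_chain (G := P) (r := PD P) (fun a b h => h.1) hx hN hy hxN h
  obtain ⟨a, b, ha, hb, hv⟩ := hAm _ h1 (possDir_chain h2).2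
  simp at ha hb
  subst ha hb
  exact hv.1

omit [Fintype V] in
theorem amen_of {P : PMG V} {cls : Set (PMG V)} (hP : IsPAGOf P cls) {X Y : Finset V}
    (hAm : Amenable P (Visible P) X Y) {R y : V} (hy : y ∈ Y) (h : ReflTransGen (PDX P X) R y) :
    Amen cls X R := by
  intro M hM x hx N hN hxN hR M2 hM2
  refine dir_of_pdir hP (amen_edge hAm hx hN hy (pd_of_dir hP hM hxN) ?_) hM2
  exact (ReflTransGen.mono (fun a b h => ⟨pd_of_dir hP hM h.1, h.2⟩) _ _ hR).trans h

section Moves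

variable {P : PMG V} {cls : Set (PMG V)} (hP : IsPAGOf P cls) {X Y : Finset V}
  (hAm : Amenable P (Visible P) X Y) {y : V} (hy : y ∈ Y)

/-- the invariant holds in all legs -/
def AllPhi (cls : Set (PMG V)) (X : Finset V) (R S : V) : Prop :=
  ∀ L, IsLeg cls L → Phi L X R S

include hP in
theorem exists_leg_dir {u w : V} (h : PD P u w) : ∃ L, IsLeg cls L ∧ L.DirEdge u w := by
  obtain ⟨M, hM, hD⟩ := exists_dir hP h
  obtain ⟨L, hL, hs⟩ := exists_leg (cls_of_pag hP) _ M rfl hM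
  exact ⟨L, hL, hs _ _ hD⟩

include hP hAm hy

theorem spread {R S : V} (h : ReflTransGen (PDX P X) R y) {L : PMG V} (hL : IsLeg cls L)
    (hp : Phi L X R S) : AllPhi cls X R S :=
  fun L2 hL2 => phi_inv (cls_of_pag hP) hL2 (amen_of hP hAm hy h) _ L rfl hL hp

theorem moveRR {R C : V} (h : ReflTransGen (PDX P X) R C) (hC : ReflTransGen (PDX P X) C y)
    (hp : AllPhi cls X R R) : AllPhi cls X C C := by
  induction h with
  | refl => exact hp
  | tail h1 h2 ih =>
    have h3 := ih (hC.head h2)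
    obtain ⟨L, hL, hD⟩ := exists_leg_dir hP h2.1
    obtain ⟨x, hx, N, hN, g1, g2, g3⟩ := h3 L hL
    exact spread hP hAm hy hC hL ⟨x, hx, N, hN, g1, g2.tail ⟨hD, h2.2⟩, g3.tail hD⟩

theorem moveR {R C S : V} (h : ReflTransGen (PDX P X) R C) (hC : ReflTransGen (PDX P X) C y)
    (hp : AllPhi cls X R S) : AllPhi cls X C S := by
  induction h with
  | refl => exact hp
  | tail h1 h2 ih =>
    have h3 := ih (hC.head h2)
    obtain ⟨L, hL, hD⟩ := exists_leg_dir hP h2.1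
    obtain ⟨x, hx, N, hN, g1, g2, g3⟩ := h3 L hL
    exact spread hP hAm hy hC hL ⟨x, hx, N, hN, g1, g2.tail ⟨hD, h2.2⟩, g3⟩

theorem moveS {S C : V} (h : ReflTransGen (PD P) S C)
    (hp : AllPhi cls X y S) : AllPhi cls X y C := by
  induction h with
  | refl => exact hp
  | tail h1 h2 ih =>
    obtain ⟨L, hL, hD⟩ := exists_leg_dir hP h2
    obtain ⟨x, hx, N, hN, g1, g2, g3⟩ := ih L hL
    exact spread hP hAm hy .refl hL ⟨x, hx, N, hN, g1, g2, g3.tail hD⟩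

end Moves

omit [Fintype V] in
theorem forbD_sub {P : PMG V} {cls : Set (PMG V)} (hP : IsPAGOf P cls) {X Y : Finset V}
    {M : PMG V} (hM : M ∈ cls) {z : V} (h : z ∈ ForbD M X Y) : z ∈ Forb P X Y := by
  have key : ∀ p : List V, DirectedAlong M p → p.IsChain P.Adj ∧ PossDirAlong P p := by
    intro p hp
    exact possDir_chain ((directedAlong_iff.1 hp).imp (fun _ _ h => pd_of_dir hP hM h))
  obtain ⟨w, hw, ⟨p, ⟨⟨h1, h2, h3⟩, h4, h5, h6⟩, h7, h8⟩, ⟨s, ⟨g1, g2, g3⟩, g4, g5, g6⟩⟩ := h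
  exact ⟨w, hw, ⟨p, ⟨⟨h1, h2, (key p h7).1⟩, h4, h5, h6⟩, (key p h7).2, h8⟩,
    ⟨s, ⟨g1, g2, (key s g4).1⟩, (key s g4).2, g5, g6⟩⟩

theorem forb_sub {P : PMG V} {cls : Set (PMG V)} (hP : IsPAGOf P cls) {X Y : Finset V}
    (hAm : Amenable P (Visible P) X Y) {z : V} (h : z ∈ Forb P X Y) :
    ∃ M ∈ cls, z ∈ ForbD M X Y := by
  obtain ⟨w, hw, ⟨p, ⟨⟨h1, h2, h3⟩, ⟨x, hx, h4⟩, ⟨y, hy, h5⟩, h6⟩, h7, h8⟩,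
    ⟨s, ⟨g1, g2, g3⟩, g4, g5, g6⟩⟩ := h
  obtain ⟨p, rfl⟩ := head_cons h4
  have hwp : w ∈ p := by
    rcases List.mem_cons.1 h8 with rfl | h
    · exact absurd hx hw
    · exact h
  obtain ⟨s, rfl⟩ := head_cons g5
  have hwz : ReflTransGen (PD P) w z := list_rtg s w (chain_possDir g3 g4) g6
  have hch := chain_possDir h3 h7
  have hpX : ∀ c ∈ p, c ∉ X := h6
  obtain ⟨p1, q, rfl⟩ : ∃ p1 q, p = p1 :: q := by
    cases p with
    | nil => simp at hwp
    | cons p1 q => exact ⟨p1, q, rfl⟩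
  have hx1 := (List.isChain_cons_cons.1 hch).1
  have hch1 := (List.isChain_cons_cons.1 hch).2
  rw [List.getLast?_cons_cons] at h5
  have hchX : (p1 :: q).IsChain (PDX P X) := (chain_iff _).2 (fun i a b ha hb =>
    ⟨(chain_iff _).1 hch1 i a b ha hb, hpX b (List.mem_of_getElem? hb)⟩)
  have hp1y : ReflTransGen (PDX P X) p1 y := list_rtg q p1 hchX h5
  have hsplit : ReflTransGen (PDX P X) p1 w ∧ ReflTransGen (PDX P X) w y := by
    obtain ⟨A, B, hAB⟩ := List.append_of_mem hwp
    constructor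
    · have e : (A ++ [w]) <+: p1 :: q := ⟨B, by rw [hAB]; simp⟩
      obtain ⟨l, hl⟩ : ∃ l, A ++ [w] = p1 :: l := by
        cases A with
        | nil => simp at hAB; exact ⟨[], by simp [hAB.1]⟩
        | cons a A => simp at hAB; exact ⟨A ++ [w], by simp [hAB.1]⟩
      have hc2 : (A ++ [w]).IsChain (PDX P X) := by
        rw [hAB, show A ++ w :: B = (A ++ [w]) ++ B by simp] at hchX
        exact hchX.left_of_append
      rw [hl] at hc2
      refine list_rtg l p1 hc2 ?_
      rw [← hl]; simp
    · rw [hAB] at hchX h5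
      rw [List.getLast?_append_of_ne_nil _ (by simp)] at h5
      exact list_rtg B w hchX.right_of_append h5
  have hp1X : p1 ∉ X := hpX p1 (by simp)
  have hd := amen_edge hAm hx hp1X hy hx1 hp1y
  have s0 : AllPhi cls X p1 p1 := fun L hL =>
    ⟨x, hx, p1, hp1X, dir_of_pdir hP hd hL.1, .refl, .refl⟩
  have s1 := moveRR hP hAm hy hsplit.1 hsplit.2 s0
  have s2 := moveR hP hAm hy hsplit.2 .refl s1
  have s3 := moveS hP hAm hy hwz s2
  obtain ⟨M, hM⟩ := hP.1
  obtain ⟨L, hL, _⟩ := exists_leg (cls_of_pag hP) _ M rfl hM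
  obtain ⟨x', hx', N, hN, k1, k2, k3⟩ := s3 L hL
  obtain ⟨l, l1, l2⟩ := proper_of_chain (G := L) (r := L.DirEdge) (fun a b h => dir_adj h)
    hx' hN hy k1 k2
  exact ⟨L, hL.1, N, hN, ⟨_, l1, directedAlong_iff.2 l2, by simp⟩, desc_iff.2 k3⟩

end PMGAux


open PMG in
/-- For an amenable PAG: condition (1) of the GAC is equivalent to condition (a)
of the AC holding in every MAG of the equivalence class. -/
theorem gac1_iff_ac_a_pag {V : Type} [Fintype V] [DecidableEq V]
    (P : PMG V) (cls : Set (PMG V)) (hP : IsPAGOf P cls) (X Y Z : Finset V)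
    (hXY : Disjoint X Y) (hX : X.Nonempty) (hY : Y.Nonempty)
    (hZ : Disjoint Z (X ∪ Y))
    (hAm : Amenable P (Visible P) X Y) :
    (∀ z ∈ Z, z ∉ Forb P X Y) ↔ (∀ M ∈ cls, ∀ z ∈ Z, z ∉ ForbD M X Y) := by
  constructor
  · intro h M hM z hz hf
    exact h z hz (PMGAux.forbD_sub hP hM hf)
  · intro h z hz hf
    obtain ⟨M, hM, hm⟩ := PMGAux.forb_sub hP hAm hf
    exact h M hM z hz hm
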